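/- For all integers d ≥ 2 and n ≥ 2, the number of tuples (p, q, (i_1,…,i_p), (k_1,…,k_q), (j_{q+1},…,j_p)) with 1 ≤ p ≤ n, 1 ≤ q ≤ p, 0 ≤ i_1 < ⋯ < i_p ≤ n−1, k_m ∈ {1,…,d−1} for 1 ≤ m ≤ q, 1 ≤ j_{q+1} < ⋯ < j_p ≤ n−1, i_m ≥ j_m for q < m ≤ p, subject to the additional congruence condition k_1 + k_2 + ⋯ + k_q ≡ 0 (mod d), equals (d−1)·𝔉_{n,n−2}(d); consequently, the dimension of the subalgebra 𝒯(d,d,n) of 𝒯(d,n) equals (d−1)·𝔉_{n,n−2}(d) + 2·C_n − 1. -/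

import Mathlib

/-- The defining relations of the Temperley–Lieb algebra `𝒯(d,n)` of the complex
reflection group `G(d,1,n)`, on the free associative `ℂ`-algebra on generators
`E_0, …, E_{n-1}`. -/
inductive TLrel (d n : ℕ) (δ : ℂ) :
    FreeAlgebra ℂ (Fin n) → FreeAlgebra ℂ (Fin n) → Prop
  | idem (i : ℕ) (h1 : 1 ≤ i) (h2 : i < n) :
      TLrel d n δ (FreeAlgebra.ι ℂ (⟨i, h2⟩ : Fin n) * FreeAlgebra.ι ℂ (⟨i, h2⟩ : Fin n))
        (δ • FreeAlgebra.ι ℂ (⟨i, h2⟩ : Fin n))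
  | powzero (h : 0 < n) :
      TLrel d n δ ((FreeAlgebra.ι ℂ (⟨0, h⟩ : Fin n)) ^ d)
        ((((d : ℂ) - 1) * δ) • FreeAlgebra.ι ℂ (⟨0, h⟩ : Fin n))
  | comm (i j : ℕ) (hij : j + 1 < i) (hi : i < n) :
      TLrel d n δ
        (FreeAlgebra.ι ℂ (⟨i, hi⟩ : Fin n) * FreeAlgebra.ι ℂ (⟨j, by omega⟩ : Fin n))
        (FreeAlgebra.ι ℂ (⟨j, by omega⟩ : Fin n) * FreeAlgebra.ι ℂ (⟨i, hi⟩ : Fin n))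
  | untwist_up (i : ℕ) (h1 : 1 ≤ i) (h2 : i + 1 < n) :
      TLrel d n δ
        (FreeAlgebra.ι ℂ (⟨i, by omega⟩ : Fin n) * FreeAlgebra.ι ℂ (⟨i + 1, h2⟩ : Fin n) *
          FreeAlgebra.ι ℂ (⟨i, by omega⟩ : Fin n))
        (FreeAlgebra.ι ℂ (⟨i, by omega⟩ : Fin n))
  | untwist_down (i : ℕ) (h1 : 1 ≤ i) (h2 : i + 1 < n) :
      TLrel d n δ
        (FreeAlgebra.ι ℂ (⟨i + 1, h2⟩ : Fin n) * FreeAlgebra.ι ℂ (⟨i, by omega⟩ : Fin n) *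
          FreeAlgebra.ι ℂ (⟨i + 1, h2⟩ : Fin n))
        (FreeAlgebra.ι ℂ (⟨i + 1, h2⟩ : Fin n))
  | rel01 (k : ℕ) (hk1 : 1 ≤ k) (hk2 : k < d) (hn : 1 < n) :
      TLrel d n δ
        (FreeAlgebra.ι ℂ (⟨0, by omega⟩ : Fin n) * FreeAlgebra.ι ℂ (⟨1, hn⟩ : Fin n) *
          (FreeAlgebra.ι ℂ (⟨0, by omega⟩ : Fin n)) ^ k * FreeAlgebra.ι ℂ (⟨1, hn⟩ : Fin n))
        (((k : ℂ) + 1) • (FreeAlgebra.ι ℂ (⟨0, by omega⟩ : Fin n) * FreeAlgebra.ι ℂ (⟨1, hn⟩ : Fin n)))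
  | rel10 (k : ℕ) (hk1 : 1 ≤ k) (hk2 : k < d) (hn : 1 < n) :
      TLrel d n δ
        (FreeAlgebra.ι ℂ (⟨1, hn⟩ : Fin n) * (FreeAlgebra.ι ℂ (⟨0, by omega⟩ : Fin n)) ^ k *
          FreeAlgebra.ι ℂ (⟨1, hn⟩ : Fin n) * FreeAlgebra.ι ℂ (⟨0, by omega⟩ : Fin n))
        (((k : ℂ) + 1) • (FreeAlgebra.ι ℂ (⟨1, hn⟩ : Fin n) * FreeAlgebra.ι ℂ (⟨0, by omega⟩ : Fin n)))

/-- The Temperley–Lieb algebra `𝒯(d,n)`. -/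
abbrev TL (d n : ℕ) (δ : ℂ) := RingQuot (TLrel d n δ)

/-- The generator `E_i` of `𝒯(d,n)` (by convention `0` for `i ≥ n`). -/
noncomputable def Egen (d n : ℕ) (δ : ℂ) (i : ℕ) : TL d n δ :=
  if h : i < n then RingQuot.mkAlgHom ℂ (TLrel d n δ) (FreeAlgebra.ι ℂ (⟨i, h⟩ : Fin n)) else 0

/-- The descending product `E_{i,j} = E_i E_{i−1} ⋯ E_j` (equal to `1` if `j = i + 1`). -/
noncomputable def Edec (d n : ℕ) (δ : ℂ) (i j : ℕ) : TL d n δ :=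
  (((List.range' j (i + 1 - j)).reverse).map (Egen d n δ)).prod

/-- The ascending product `E^{j,i} = E_j E_{j+1} ⋯ E_i` (equal to `1` if `i = j - 1`). -/
noncomputable def Einc (d n : ℕ) (δ : ℂ) (j i : ℕ) : TL d n δ :=
  ((List.range' j (i + 1 - j)).map (Egen d n δ)).prod

/-- The `n`-th Catalan number `C_n = binom(2n,n)/(n+1)`. -/
def catalanNum (n : ℕ) : ℕ := (2 * n).choose n / (n + 1)

/-- The Catalan triangle entry `C(n,k) = (n+k)!·(n−k+1)/(k!·(n+1)!)`. -/
def catalanTri (n k : ℕ) : ℕ :=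
  ((n + k).factorial * (n - k + 1)) / (k.factorial * (n + 1).factorial)

/-- The Catalan triangle polynomial `𝔉_{n,k}(x) = Σ_{s=0}^k C(n,s)·x^{k−s}`. -/
def catalanTriPoly (n k x : ℕ) : ℕ :=
  ∑ s ∈ Finset.range (k + 1), catalanTri n s * x ^ (k - s)

/-- Standard monomials of type (i): `E_{i_1,j_1} ⋯ E_{i_p,j_p}`. -/
def IsStdMonI (d n : ℕ) (δ : ℂ) (x : TL d n δ) : Prop :=
  ∃ (p : ℕ) (I J : ℕ → ℕ),
    p ≤ n - 1 ∧
    (∀ m, m < p → 1 ≤ I m ∧ I m ≤ n - 1 ∧ 1 ≤ J m ∧ J m ≤ n - 1 ∧ J m ≤ I m) ∧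
    (∀ m, m + 1 < p → I m < I (m + 1) ∧ J m < J (m + 1)) ∧
    x = ((List.range p).map (fun m => Edec d n δ (I m) (J m))).prod

/-- Standard monomials of type (ii) satisfying `k_1 + ⋯ + k_q ≡ 0 (mod d)`:
`(E_{i_1,1}E_0^{k_1}) ⋯ (E_{i_q,1}E_0^{k_q}) E_{i_{q+1},j_{q+1}} ⋯ E_{i_p,j_p}`. -/
def IsStdMonIIModD (d n : ℕ) (δ : ℂ) (x : TL d n δ) : Prop :=
  ∃ (p q : ℕ) (I K J : ℕ → ℕ),
    1 ≤ p ∧ p ≤ n ∧ 1 ≤ q ∧ q ≤ p ∧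
    (∀ m, m < p → I m ≤ n - 1) ∧
    (∀ m, m + 1 < p → I m < I (m + 1)) ∧
    (∀ m, m < q → 1 ≤ K m ∧ K m ≤ d - 1) ∧
    (∑ m ∈ Finset.range q, K m) % d = 0 ∧
    (∀ m, q ≤ m → m < p → 1 ≤ J m ∧ J m ≤ n - 1 ∧ J m ≤ I m) ∧
    (∀ m, q ≤ m → m + 1 < p → J m < J (m + 1)) ∧
    x = ((List.range q).map (fun m => Edec d n δ (I m) 1 * (Egen d n δ 0) ^ (K m))).prod *
        ((List.range' q (p - q)).map (fun m => Edec d n δ (I m) (J m))).prod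

/-- Standard monomials of type (iii) with `k = 1`:
`(E_{i_1,1}E_0E^{1,j_1}) E_{i_2,j_2} ⋯ E_{i_p,j_p}`. -/
def IsStdMonIIIOne (d n : ℕ) (δ : ℂ) (x : TL d n δ) : Prop :=
  ∃ (p : ℕ) (I J : ℕ → ℕ),
    1 ≤ p ∧ p ≤ n - 1 ∧
    (∀ m, m < p → 1 ≤ I m ∧ I m ≤ n - 1 ∧ 1 ≤ J m ∧ J m ≤ n - 1 ∧ J m ≤ I m) ∧
    (∀ m, m + 1 < p → I m < I (m + 1) ∧ J m < J (m + 1)) ∧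
    x = (Edec d n δ (I 0) 1 * Egen d n δ 0 * Einc d n δ 1 (J 0)) *
        ((List.range' 1 (p - 1)).map (fun m => Edec d n δ (I m) (J m))).prod

/-- The spanning set of monomials of the subalgebra `𝒯(d,d,n)` of `𝒯(d,n)`. -/
def spanSetTddn (d n : ℕ) (δ : ℂ) : Set (TL d n δ) :=
  {x | IsStdMonI d n δ x ∨ IsStdMonIIModD d n δ x ∨ IsStdMonIIIOne d n δ x}

/-- A perfect matching of `ℤ` whose arcs carry natural number decorations. The points `a ≥ 1`
are the strands acted upon by the generators. -/
@[ext]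
structure LinkState where
  /-- The other end of the arc at a point. -/
  partner : ℤ → ℤ
  /-- The decoration of the arc at a point. -/
  deco : ℤ → ℕ
  partner_partner : ∀ a, partner (partner a) = a
  partner_ne : ∀ a, partner a ≠ a
  deco_partner : ∀ a, deco (partner a) = deco a

namespace LinkState

/-- Joins the arcs at `i` and `i + 1`, and adds an undecorated arc from `i` to `i + 1`. -/
def join (i : ℤ) (s : LinkState) : LinkState where
  partner x := if x = i then i + 1 else if x = i + 1 then i else
    if x = s.partner i then s.partner (i + 1) else
    if x = s.partner (i + 1) then s.partner i else s.partner x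
  deco x := if x = i ∨ x = i + 1 then 0 else
    if x = s.partner i ∨ x = s.partner (i + 1) then s.deco i + s.deco (i + 1) else s.deco x
  partner_partner a := by
    have h1 := s.partner_partner
    have h2 := s.partner_ne
    grind
  partner_ne a := by
    have h1 := s.partner_partner
    have h2 := s.partner_ne
    grind
  deco_partner a := by
    have h1 := s.partner_partner
    have h2 := s.partner_ne
    have h3 := s.deco_partner
    grind

/-- Replaces the decoration of the arc at `p` by `v`. -/
def setDeco (p : ℤ) (v : ℕ) (s : LinkState) : LinkState where
  partner := s.partner
  deco x := if x = p ∨ x = s.partner p then v else s.deco x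
  partner_partner := s.partner_partner
  partner_ne := s.partner_ne
  deco_partner a := by
    have h1 := s.partner_partner
    have h3 := s.deco_partner
    grind

/-- Adds `k` to the decoration of the arc at `1`. -/
def dot (k : ℕ) (s : LinkState) : LinkState := s.setDeco 1 (s.deco 1 + k)

theorem join_join (i : ℤ) (s : LinkState) : (s.join i).join i = s.join i := by
  ext x <;> simp only [join] <;> grind

theorem join_join_succ_join (i : ℤ) (s : LinkState) :
    ((s.join i).join (i + 1)).join i = s.join i := by
  have h1 := s.partner_partner
  have h2 := s.partner_ne
  have h3 := s.deco_partner
  ext x <;> simp only [join] <;> grind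

theorem join_succ_join_join_succ (i : ℤ) (s : LinkState) :
    ((s.join (i + 1)).join i).join (i + 1) = s.join (i + 1) := by
  have h1 := s.partner_partner
  have h2 := s.partner_ne
  have h3 := s.deco_partner
  ext x <;> simp only [join] <;> grind

theorem join_comm {i j : ℤ} (hij : j + 1 < i) (s : LinkState) :
    (s.join i).join j = (s.join j).join i := by
  have h1 := s.partner_partner
  have h2 := s.partner_ne
  have h3 := s.deco_partner
  obtain ⟨i', hi'⟩ : ∃ i', i + 1 = i' := ⟨_, rfl⟩
  obtain ⟨j', hj'⟩ : ∃ j', j + 1 = j' := ⟨_, rfl⟩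
  have n1 : i ≠ i' := by lia
  have n2 : j ≠ j' := by lia
  have n3 : i ≠ j := by lia
  have n4 : i ≠ j' := by lia
  have n5 : i' ≠ j := by lia
  have n6 : i' ≠ j' := by lia
  ext x <;> simp only [join, hi', hj'] <;> clear hi' hj' hij <;> grind (splits := 40)

theorem dot_join {i : ℤ} (hi : 1 < i) (k : ℕ) (s : LinkState) :
    (s.dot k).join i = (s.join i).dot k := by
  have h1 := s.partner_partner
  have h2 := s.partner_ne
  have h3 := s.deco_partner
  ext x <;> simp only [join, dot, setDeco] <;> grind

theorem join_dot_join (k : ℕ) (s : LinkState) :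
    (((s.join 1).dot k)).join 1 = s.join 1 := by
  have h1 := s.partner_partner
  have h2 := s.partner_ne
  have h3 := s.deco_partner
  ext x <;> simp only [join, dot, setDeco] <;> grind

theorem dot_dot (k l : ℕ) (s : LinkState) : (s.dot k).dot l = s.dot (k + l) := by
  ext x <;> simp only [dot, setDeco]
  grind

theorem dot_zero (s : LinkState) : s.dot 0 = s := by
  have h3 := s.deco_partner
  ext x <;> simp only [dot, setDeco]
  grind

/-- The factor produced by `join i`: the value of the closed loop, if one appears. -/
def loopWeight (f : ℕ → ℂ) (i : ℤ) (s : LinkState) : ℂ :=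
  if s.partner i = i + 1 then f (s.deco i) else 1

theorem loopWeight_join (f : ℕ → ℂ) (i : ℤ) (s : LinkState) :
    (s.join i).loopWeight f i = f 0 := by
  simp [loopWeight, join]

theorem loopWeight_dot_join (f : ℕ → ℂ) (k : ℕ) (s : LinkState) :
    ((s.join 1).dot k).loopWeight f 1 = f k := by
  simp [loopWeight, join, dot, setDeco]

theorem loopWeight_succ_join (f : ℕ → ℂ) (i : ℤ) (s : LinkState) :
    (s.join i).loopWeight f (i + 1) = 1 := by
  simp only [loopWeight, join]
  grind

theorem loopWeight_join_succ (f : ℕ → ℂ) (i : ℤ) (s : LinkState) :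
    (s.join (i + 1)).loopWeight f i = 1 := by
  have h1 := s.partner_partner
  have h2 := s.partner_ne
  simp only [loopWeight, join]
  grind

theorem loopWeight_join_join_succ (f : ℕ → ℂ) (i : ℤ) (s : LinkState) :
    ((s.join i).join (i + 1)).loopWeight f i = 1 := by
  exact loopWeight_join_succ f i _

theorem loopWeight_join_succ_join (f : ℕ → ℂ) (i : ℤ) (s : LinkState) :
    ((s.join (i + 1)).join i).loopWeight f (i + 1) = 1 :=
  loopWeight_succ_join f i _

theorem loopWeight_comm (f : ℕ → ℂ) {i j : ℤ} (hij : j + 1 < i) (s : LinkState) :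
    s.loopWeight f i * (s.join i).loopWeight f j =
      s.loopWeight f j * (s.join j).loopWeight f i := by
  have h1 := s.partner_partner
  have h2 := s.partner_ne
  have h3 := s.deco_partner
  simp only [loopWeight, join]
  grind

theorem loopWeight_dot (f : ℕ → ℂ) {i : ℤ} (hi : 1 < i) (k : ℕ) (s : LinkState) :
    (s.dot k).loopWeight f i = s.loopWeight f i := by
  have h1 := s.partner_partner
  simp only [loopWeight, dot, setDeco]
  grind

theorem join_setDeco_of_ne {i p : ℤ} {s : LinkState} (h1 : p ≠ i) (h2 : p ≠ i + 1)
    (h3 : p ≠ s.partner i) (h4 : p ≠ s.partner (i + 1)) (v : ℕ) :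
    (s.setDeco p v).join i = (s.join i).setDeco p v := by
  have h1 := s.partner_partner
  have h2 := s.partner_ne
  have h3 := s.deco_partner
  ext x <;> simp only [join, setDeco] <;> grind

theorem join_setDeco_left {i : ℤ} {s : LinkState} (h : s.partner i ≠ i + 1) (v : ℕ) :
    (s.setDeco i v).join i = (s.join i).setDeco (s.partner i) (v + s.deco (i + 1)) := by
  have h1 := s.partner_partner
  have h2 := s.partner_ne
  have h3 := s.deco_partner
  ext x <;> simp only [join, setDeco] <;> grind

theorem join_setDeco_right {i : ℤ} {s : LinkState} (h : s.partner i ≠ i + 1) (v : ℕ) :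
    (s.setDeco (i + 1) v).join i = (s.join i).setDeco (s.partner i) (v + s.deco i) := by
  have h1 := s.partner_partner
  have h2 := s.partner_ne
  have h3 := s.deco_partner
  ext x <;> simp only [join, setDeco] <;> grind

theorem join_setDeco_loop {i : ℤ} {s : LinkState} (h : s.partner i = i + 1) (v : ℕ) :
    (s.setDeco i v).join i = s.join i := by
  have h1 := s.partner_partner
  have h2 := s.partner_ne
  have h3 := s.deco_partner
  ext x <;> simp only [join, setDeco] <;> grind

theorem setDeco_partner (p : ℤ) (v : ℕ) (s : LinkState) :
    s.setDeco (s.partner p) v = s.setDeco p v := by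
  have h1 := s.partner_partner
  ext x <;> simp only [setDeco]
  grind

end LinkState

/-- The coefficients of the powers of an element `b` with `b ^ d = c * b`: extends `g` from the
range `k < d` to all `k`. -/
noncomputable def extendDeco (d : ℕ) (c : ℂ) (g : ℕ → ℂ) (k : ℕ) : ℂ :=
  if k = 0 then g 0 else c ^ ((k - 1) / (d - 1)) * g ((k - 1) % (d - 1) + 1)

theorem extendDeco_of_lt {d : ℕ} (c : ℂ) (g : ℕ → ℂ) {k : ℕ} (hk : k < d) :
    extendDeco d c g k = g k := by
  unfold extendDeco
  split_ifs with h
  · rw [h]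
  · rw [Nat.div_eq_of_lt (by omega), Nat.mod_eq_of_lt (by omega), pow_zero, one_mul,
      Nat.sub_add_cancel (by omega)]

theorem extendDeco_add {d : ℕ} (hd : 2 ≤ d) (c : ℂ) (g : ℕ → ℂ) {k : ℕ} (hk : 1 ≤ k) :
    extendDeco d c g (k + (d - 1)) = c * extendDeco d c g k := by
  unfold extendDeco
  rw [if_neg (by omega), if_neg (by omega),
    show k + (d - 1) - 1 = k - 1 + (d - 1) by omega, Nat.add_div_right _ (by omega),
    Nat.add_mod_right, pow_succ]
  ring

/-- The functions of link states in which `d - 1` dots on a dotted arc can be traded for the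
factor `c`. -/
def dotReduced (d : ℕ) (c : ℂ) : Submodule ℂ (LinkState → ℂ) where
  carrier := {F | ∀ s p v, 1 ≤ v →
    F (LinkState.setDeco p (v + (d - 1)) s) = c * F (LinkState.setDeco p v s)}
  add_mem' {F G} hF hG s p v hv := by
    simp only [Pi.add_apply, hF s p v hv, hG s p v hv, mul_add]
  zero_mem' s p v hv := by simp
  smul_mem' a F hF s p v hv := by
    simp only [Pi.smul_apply, hF s p v hv, smul_eq_mul, mul_left_comm]

namespace LinkState

/-- The generator `E_i`, `i ≥ 1`, acting on functions of link states. -/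
def joinOp (f : ℕ → ℂ) (i : ℤ) : (LinkState → ℂ) →ₗ[ℂ] (LinkState → ℂ) where
  toFun F s := s.loopWeight f i * F (s.join i)
  map_add' F G := by ext s; simp [mul_add]
  map_smul' a F := by ext s; simp [mul_left_comm]

/-- The generator `E_0` acting on functions of link states. -/
def dotOp : (LinkState → ℂ) →ₗ[ℂ] (LinkState → ℂ) where
  toFun F s := F (s.dot 1)
  map_add' _ _ := rfl
  map_smul' _ _ := rfl

theorem joinOp_mem {d : ℕ} {c : ℂ} {f : ℕ → ℂ}
    (hf : ∀ v, 1 ≤ v → f (v + (d - 1)) = c * f v) (i : ℤ) {F : LinkState → ℂ}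
    (hF : F ∈ dotReduced d c) : joinOp f i F ∈ dotReduced d c := by
  intro s p v hv
  change loopWeight f i _ * F (join i _) = c * (loopWeight f i _ * F (join i _))
  have pp := s.partner_partner
  have pn := s.partner_ne
  by_cases hl : s.partner i = i + 1
  · by_cases hp : p = i ∨ p = i + 1
    · have hs : ∀ v, s.setDeco p v = s.setDeco i v := by
        intro v
        rcases hp with rfl | rfl
        · rfl
        · rw [← hl, setDeco_partner]
      have hw : ∀ v, loopWeight f i (s.setDeco i v) = f v := by
        intro v
        simp [loopWeight, setDeco, hl]
      rw [hs, hs, join_setDeco_loop hl, join_setDeco_loop hl, hw, hw, hf v hv, mul_assoc]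
    · have hw : ∀ v, loopWeight f i (s.setDeco p v) = loopWeight f i s := by
        intro v
        simp only [loopWeight, setDeco]
        grind
      rw [join_setDeco_of_ne (by grind) (by grind) (by grind) (by grind),
        join_setDeco_of_ne (by grind) (by grind) (by grind) (by grind), hw, hw, hF _ _ _ hv,
        mul_left_comm]
  · have hw : ∀ v, loopWeight f i (s.setDeco p v) = 1 := by
      intro v
      simp [loopWeight, setDeco, hl]
    rw [hw, hw, one_mul, one_mul]
    by_cases h1 : p = i ∨ p = s.partner i
    · have hs : ∀ v, s.setDeco p v = s.setDeco i v := by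
        intro v
        rcases h1 with rfl | rfl
        · rfl
        · rw [setDeco_partner]
      rw [hs, hs, join_setDeco_left hl, join_setDeco_left hl, add_right_comm, hF _ _ _ (by omega)]
    by_cases h2 : p = i + 1 ∨ p = s.partner (i + 1)
    · have hs : ∀ v, s.setDeco p v = s.setDeco (i + 1) v := by
        intro v
        rcases h2 with rfl | rfl
        · rfl
        · rw [setDeco_partner]
      rw [hs, hs, join_setDeco_right hl, join_setDeco_right hl, add_right_comm,
        hF _ _ _ (by omega)]
    rw [join_setDeco_of_ne (by grind) (by grind) (by grind) (by grind),
      join_setDeco_of_ne (by grind) (by grind) (by grind) (by grind), hF _ _ _ hv]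

theorem dot_setDeco_of_ne {p : ℤ} {s : LinkState} (h1 : p ≠ 1) (h2 : p ≠ s.partner 1) (v : ℕ) :
    (s.setDeco p v).dot 1 = (s.dot 1).setDeco p v := by
  have h1 := s.partner_partner
  ext x <;> simp only [dot, setDeco]
  grind

theorem dot_setDeco_one (s : LinkState) (v : ℕ) :
    (s.setDeco 1 v).dot 1 = s.setDeco 1 (v + 1) := by
  ext x <;> simp only [dot, setDeco]
  grind

theorem dotOp_mem {d : ℕ} {c : ℂ} {F : LinkState → ℂ}
    (hF : F ∈ dotReduced d c) : dotOp F ∈ dotReduced d c := by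
  intro s p v hv
  change F (dot 1 _) = c * F (dot 1 _)
  by_cases h1 : p = 1 ∨ p = s.partner 1
  · have hs : ∀ v, s.setDeco p v = s.setDeco 1 v := by
      intro v
      rcases h1 with rfl | rfl
      · rfl
      · rw [setDeco_partner]
    rw [hs, hs, dot_setDeco_one, dot_setDeco_one, add_right_comm, hF _ _ _ (by omega)]
  · push Not at h1
    rw [dot_setDeco_of_ne h1.1 h1.2, dot_setDeco_of_ne h1.1 h1.2, hF _ _ _ hv]

end LinkState

/-- The value of a loop with `k` dots. -/
noncomputable def dottedLoop (d : ℕ) (δ : ℂ) : ℕ → ℂ :=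
  extendDeco d (((d : ℂ) - 1) * δ) fun k => if k = 0 then δ else (k : ℂ) + 1

section Representation

variable {d : ℕ} (hd : 2 ≤ d) (δ : ℂ)

/-- The space on which `𝒯(d,n)` is represented. -/
abbrev LinkModule (d : ℕ) (δ : ℂ) : Type := dotReduced d (((d : ℂ) - 1) * δ)

/-- The action of `E_i`, `i ≥ 1`, on `LinkModule`. -/
noncomputable def joinEnd (i : ℤ) : Module.End ℂ (LinkModule d δ) :=
  (LinkState.joinOp (dottedLoop d δ) i).restrict fun _ hF =>
    LinkState.joinOp_mem (fun _ hv => extendDeco_add hd _ _ hv) i hF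

/-- The action of `E_0` on `LinkModule`. -/
noncomputable def dotEnd : Module.End ℂ (LinkModule d δ) :=
  LinkState.dotOp.restrict fun _ hF => LinkState.dotOp_mem hF

theorem joinEnd_apply (i : ℤ) (F : LinkModule d δ) (s : LinkState) :
    (joinEnd hd δ i F).1 s = s.loopWeight (dottedLoop d δ) i * F.1 (s.join i) := rfl

theorem dotEnd_pow_apply (k : ℕ) (F : LinkModule d δ) (s : LinkState) :
    ((dotEnd δ ^ k) F).1 s = F.1 (s.dot k) := by
  induction k generalizing s with
  | zero => rw [LinkState.dot_zero]; rfl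
  | succ k ih =>
    rw [pow_succ']
    change ((dotEnd δ ^ k) F).1 (s.dot 1) = _
    rw [ih, LinkState.dot_dot, add_comm]

theorem dottedLoop_zero : dottedLoop d δ 0 = δ := by
  simp [dottedLoop, extendDeco]

theorem dottedLoop_of_lt {k : ℕ} (h1 : 1 ≤ k) (h2 : k < d) : dottedLoop d δ k = (k : ℂ) + 1 := by
  rw [dottedLoop, extendDeco_of_lt _ _ h2, if_neg (by omega)]

theorem joinEnd_mul_self (i : ℤ) : joinEnd hd δ i * joinEnd hd δ i = δ • joinEnd hd δ i := by
  refine LinearMap.ext fun F => Subtype.ext (funext fun s => ?_)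
  rw [Module.End.mul_apply, LinearMap.smul_apply, Submodule.coe_smul, Pi.smul_apply, smul_eq_mul,
    joinEnd_apply, joinEnd_apply, joinEnd_apply, LinkState.loopWeight_join, LinkState.join_join,
    dottedLoop_zero]
  ring

theorem joinEnd_mul_succ_mul (i : ℤ) :
    joinEnd hd δ i * joinEnd hd δ (i + 1) * joinEnd hd δ i = joinEnd hd δ i := by
  refine LinearMap.ext fun F => Subtype.ext (funext fun s => ?_)
  rw [Module.End.mul_apply, Module.End.mul_apply, joinEnd_apply, joinEnd_apply, joinEnd_apply,
    joinEnd_apply, LinkState.loopWeight_join_join_succ, LinkState.loopWeight_succ_join,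
    LinkState.join_join_succ_join]
  ring

theorem joinEnd_succ_mul_mul_succ (i : ℤ) :
    joinEnd hd δ (i + 1) * joinEnd hd δ i * joinEnd hd δ (i + 1) = joinEnd hd δ (i + 1) := by
  refine LinearMap.ext fun F => Subtype.ext (funext fun s => ?_)
  rw [Module.End.mul_apply, Module.End.mul_apply, joinEnd_apply, joinEnd_apply, joinEnd_apply,
    joinEnd_apply, LinkState.loopWeight_join_succ_join, LinkState.loopWeight_join_succ,
    LinkState.join_succ_join_join_succ]
  ring

theorem joinEnd_comm {i j : ℤ} (hij : j + 1 < i) :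
    joinEnd hd δ i * joinEnd hd δ j = joinEnd hd δ j * joinEnd hd δ i := by
  refine LinearMap.ext fun F => Subtype.ext (funext fun s => ?_)
  rw [Module.End.mul_apply, Module.End.mul_apply, joinEnd_apply, joinEnd_apply, joinEnd_apply,
    joinEnd_apply, ← mul_assoc, ← mul_assoc, LinkState.loopWeight_comm _ hij,
    LinkState.join_comm hij]

theorem joinEnd_mul_dotEnd {i : ℤ} (hi : 1 < i) :
    joinEnd hd δ i * dotEnd δ = dotEnd δ * joinEnd hd δ i := by
  refine LinearMap.ext fun F => Subtype.ext (funext fun s => ?_)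
  rw [← pow_one (dotEnd δ), Module.End.mul_apply, Module.End.mul_apply, joinEnd_apply,
    dotEnd_pow_apply, dotEnd_pow_apply, joinEnd_apply, LinkState.loopWeight_dot _ hi,
    LinkState.dot_join hi]

theorem dotEnd_pow_self (hd : 2 ≤ d) :
    dotEnd δ ^ d = (((d : ℂ) - 1) * δ) • (dotEnd δ : Module.End ℂ (LinkModule d δ)) := by
  refine LinearMap.ext fun F => Subtype.ext (funext fun s => ?_)
  rw [dotEnd_pow_apply, LinearMap.smul_apply, Submodule.coe_smul, Pi.smul_apply, smul_eq_mul,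
    ← pow_one (dotEnd δ), dotEnd_pow_apply, LinkState.dot, LinkState.dot,
    show s.deco 1 + d = s.deco 1 + 1 + (d - 1) by omega]
  exact F.2 _ _ _ (by omega)

theorem joinEnd_mul_dotEnd_pow_mul {k : ℕ} (h1 : 1 ≤ k) (h2 : k < d) :
    joinEnd hd δ 1 * dotEnd δ ^ k * joinEnd hd δ 1 = ((k : ℂ) + 1) • joinEnd hd δ 1 := by
  refine LinearMap.ext fun F => Subtype.ext (funext fun s => ?_)
  rw [Module.End.mul_apply, Module.End.mul_apply, LinearMap.smul_apply, Submodule.coe_smul,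
    Pi.smul_apply, smul_eq_mul, joinEnd_apply, dotEnd_pow_apply, joinEnd_apply, joinEnd_apply,
    LinkState.loopWeight_dot_join, LinkState.join_dot_join, dottedLoop_of_lt δ h1 h2]
  ring

/-- The images of the generators of `𝒯(d,n)`, with a prescribed image of `E_0`. -/
noncomputable def genEnd (e : Module.End ℂ (LinkModule d δ)) (i : ℕ) :
    Module.End ℂ (LinkModule d δ) :=
  if i = 0 then e else joinEnd hd δ i

theorem exists_representation (n : ℕ) (e : Module.End ℂ (LinkModule d δ))
    (h0 : e = dotEnd δ ∨ e = 0) :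
    ∃ φ : TL d n δ →ₐ[ℂ] Module.End ℂ (LinkModule d δ),
      ∀ i, i < n → φ (Egen d n δ i) = genEnd hd δ e i := by
  let g : FreeAlgebra ℂ (Fin n) →ₐ[ℂ] Module.End ℂ (LinkModule d δ) :=
    FreeAlgebra.lift ℂ fun i : Fin n => genEnd hd δ e i
  have hg : ∀ i : Fin n, g (FreeAlgebra.ι ℂ i) = genEnd hd δ e i := fun i => by
    simp [g]
  have hj : ∀ i, 1 ≤ i → genEnd hd δ e i = joinEnd hd δ i := fun i hi => if_neg (by omega)
  have h00 : genEnd hd δ e 0 = e := if_pos rfl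
  have hrel : ∀ ⦃x y⦄, TLrel d n δ x y → g x = g y := by
    intro x y h
    induction h with
    | idem i h1 h2 =>
      simp only [map_mul, map_smul, hg, hj i h1]
      exact joinEnd_mul_self hd δ i
    | powzero h =>
      simp only [map_pow, map_smul, hg, h00]
      rcases h0 with rfl | rfl
      · exact dotEnd_pow_self δ hd
      · rw [zero_pow (by omega), smul_zero]
    | comm i j hij hi =>
      simp only [map_mul, hg, hj i (by omega)]
      rcases Nat.eq_zero_or_pos j with rfl | h
      · rw [h00]
        rcases h0 with rfl | rfl
        · exact joinEnd_mul_dotEnd hd δ (by lia)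
        · rw [mul_zero, zero_mul]
      · rw [hj j h]
        exact joinEnd_comm hd δ (by lia)
    | untwist_up i h1 h2 =>
      simp only [map_mul, hg, hj i h1, hj (i + 1) (by omega)]
      exact joinEnd_mul_succ_mul hd δ i
    | untwist_down i h1 h2 =>
      simp only [map_mul, hg, hj i h1, hj (i + 1) (by omega)]
      exact joinEnd_succ_mul_mul_succ hd δ i
    | rel01 k h1 h2 hn =>
      simp only [map_mul, map_pow, map_smul, hg, h00, hj 1 le_rfl, Nat.cast_one]
      rcases h0 with rfl | rfl
      · rw [mul_assoc, mul_assoc, ← mul_assoc (joinEnd hd δ 1),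
          joinEnd_mul_dotEnd_pow_mul hd δ h1 h2, mul_smul_comm]
      · simp
    | rel10 k h1 h2 hn =>
      simp only [map_mul, map_pow, map_smul, hg, h00, hj 1 le_rfl, Nat.cast_one]
      rcases h0 with rfl | rfl
      · rw [joinEnd_mul_dotEnd_pow_mul hd δ h1 h2, smul_mul_assoc]
      · simp
  refine ⟨RingQuot.liftAlgHom ℂ ⟨g, hrel⟩, fun i hi => ?_⟩
  rw [Egen, dif_pos hi, RingQuot.liftAlgHom_mkAlgHom_apply, hg]

end Representation

namespace LinkState

/-- The state of the identity diagram: the strand `a ≥ 1` ends at the point `1 - a`. -/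
def vertical : LinkState where
  partner a := 1 - a
  deco _ := 0
  partner_partner a := by ring
  partner_ne a := by lia
  deco_partner _ := rfl

/-- The strands with number greater than `m` are vertical and undecorated. -/
def IsVerticalAbove (m : ℤ) (s : LinkState) : Prop :=
  ∀ a, m < a → s.partner a = 1 - a ∧ s.deco a = 0

/-- There is no undecorated arc from `a` to `a + 1` for `a ≥ b`. -/
def NoBareCup (b : ℤ) (s : LinkState) : Prop :=
  ∀ a, b ≤ a → s.partner a = a + 1 → s.deco a ≠ 0

/-- The relabelling of the points caused by `E_{m,i}`. -/
def shift (m i a : ℤ) : ℤ :=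
  if a = m then -m else if i ≤ a ∧ a < m then a + 2 else a

/-- `s'` arises from `s` by `E_{m,i}`. -/
structure IsShifted (m i : ℤ) (s s' : LinkState) : Prop where
  partner_cup : s'.partner i = i + 1
  deco_cup : s'.deco i = 0
  partner_shift : ∀ a, a ≠ m + 1 → a ≠ -m → s'.partner (shift m i a) = shift m i (s.partner a)
  deco_shift : ∀ a, a ≠ m + 1 → a ≠ -m → s'.deco (shift m i a) = s.deco a

theorem IsVerticalAbove.isShifted_join {m : ℤ} (hm : 1 ≤ m) {s : LinkState}
    (hs : s.IsVerticalAbove m) : IsShifted m m s (s.join m) := by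
  have h1 := s.partner_partner
  have h2 := s.partner_ne
  have h3 := s.deco_partner
  have h4 := hs (m + 1) (by lia)
  constructor
  · simp [join]
  · simp [join]
  · intro a ha ha'
    simp only [join, shift]
    grind
  · intro a ha ha'
    simp only [join, shift]
    grind

theorem IsShifted.join {m i : ℤ} (hi : 1 ≤ i) (him : i < m) {s s' : LinkState}
    (hs : s.IsVerticalAbove m) (h : IsShifted m (i + 1) s s') :
    IsShifted m i s (s'.join i) := by
  have h1 := s.partner_partner
  have h2 := s.partner_ne
  have h4 := hs (m + 1) (by lia)
  have h1' := s'.partner_partner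
  have h2' := s'.partner_ne
  have h3' := s'.deco_partner
  have ei : shift m (i + 1) i = i := by unfold shift; grind
  have p1 := h.partner_cup
  have p2 := h.deco_cup
  have hp := h.partner_shift i (by lia) (by lia)
  have hd := h.deco_shift i (by lia) (by lia)
  rw [ei] at hp hd
  have key : ∀ a, shift m i a = if a = i then i + 2 else shift m (i + 1) a := by
    intro a; unfold shift; grind
  have ne1 : ∀ a, a ≠ m + 1 → shift m (i + 1) a ≠ i + 1 := by
    intro a ha; unfold shift; grind
  have ne2 : ∀ a, a ≠ m + 1 → shift m (i + 1) a ≠ i + 2 := by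
    intro a ha; unfold shift; grind
  have inj : ∀ a b, a ≠ -m → b ≠ -m → a ≠ m + 1 → b ≠ m + 1 →
      shift m (i + 1) a = shift m (i + 1) b → a = b := by
    intro a b; unfold shift; grind
  have stay : ∀ a, a ≠ m + 1 → a ≠ -m → s.partner a ≠ m + 1 ∧ s.partner a ≠ -m := by
    intro a _ _; grind
  constructor
  · simp [LinkState.join]
  · simp [LinkState.join]
  · intro a ha ha'
    have q := h.partner_shift a ha ha'
    have q2 := stay a ha ha'
    have q3 := stay i (by lia) (by lia)
    have n1 := ne1 a ha
    have n2 := ne2 a ha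
    have i1 := inj a i ha' (by lia) ha (by lia)
    have i2 := inj a (s.partner i) ha' q3.2 ha q3.1
    rw [key, key]
    simp only [LinkState.join]
    have e2 : i + 1 + 1 = i + 2 := by ring
    rw [e2] at p1
    rw [p1]
    grind
  · intro a ha ha'
    have q := h.deco_shift a ha ha'
    have q2 := stay a ha ha'
    have q3 := stay i (by lia) (by lia)
    have n1 := ne1 a ha
    have n2 := ne2 a ha
    have i1 := inj a i ha' (by lia) ha (by lia)
    have i2 := inj a (s.partner i) ha' q3.2 ha q3.1
    have h3 := s.deco_partner
    rw [key]
    simp only [LinkState.join]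
    have e2 : i + 1 + 1 = i + 2 := by ring
    rw [e2] at p1
    rw [p1]
    grind

theorem IsShifted.isVerticalAbove {m i : ℤ} (hi : 1 ≤ i) (him : i ≤ m) {s s' : LinkState}
    (hs : s.IsVerticalAbove m) (h : IsShifted m i s s') : s'.IsVerticalAbove (m + 1) := by
  intro a ha
  have h4 := hs a (by lia)
  have h1 := h.partner_shift a (by lia) (by lia)
  have h2 := h.deco_shift a (by lia) (by lia)
  have e1 : shift m i a = a := by unfold shift; grind
  have e2 : shift m i (1 - a) = 1 - a := by unfold shift; grind
  rw [h4.1, e1, e2] at h1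
  rw [h4.2, e1] at h2
  exact ⟨h1, h2⟩

theorem IsShifted.noBareCup {m i : ℤ} (hi : 1 ≤ i) (him : i ≤ m) {s s' : LinkState}
    (hs : s.IsVerticalAbove m) (hb : s.NoBareCup i) (h : IsShifted m i s s') :
    s'.NoBareCup (i + 1) := by
  intro a ha hp hd
  have hv := h.isVerticalAbove hi him hs
  have h1' := s'.partner_partner
  have hi' := h.partner_cup
  have ha1 : a ≠ i + 1 := by grind
  by_cases h2 : m + 1 < a
  · have := (hv a h2).1
    lia
  have h5 := hs (m + 1) (by lia)
  have hp1 := s.partner_partner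
  have e1 : shift m i (a - 2) = a := by unfold shift; grind
  have q1 := h.partner_shift (a - 2) (by lia) (by lia)
  have q2 := h.deco_shift (a - 2) (by lia) (by lia)
  rw [e1] at q1 q2
  by_cases h3 : a = m + 1
  · have := hv (a + 1) (by lia)
    grind
  have q3 : s.partner (a - 2) = a - 2 + 1 := by
    have q4 : s.partner (a - 2) ≠ m + 1 ∧ s.partner (a - 2) ≠ -m := by grind
    rw [hp] at q1
    unfold shift at q1
    grind
  exact hb (a - 2) (by lia) q3 (by rw [← q2, hd])

theorem IsShifted.not_vertical {m i : ℤ} (hi : 1 ≤ i) (him : i ≤ m) {s s' : LinkState}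
    (hs : s.IsVerticalAbove m) (hb : s.NoBareCup i) (h : IsShifted m i s s') :
    ¬(s'.partner (m + 1) = -m ∧ s'.deco (m + 1) = 0) := by
  rintro ⟨hp, hd⟩
  have hv := h.isVerticalAbove hi him hs
  have h1' := s'.partner_partner
  have h3' := s'.deco_partner
  have hi' := h.partner_cup
  have h5 := hs (m + 1) (by lia)
  have hp1 := s.partner_partner
  have e1 : shift m i m = -m := by unfold shift; grind
  have q1 := h.partner_shift m (by lia) (by lia)
  have q2 := h.deco_shift m (by lia) (by lia)
  rw [e1] at q1 q2
  have q4 : s.partner m ≠ m + 1 ∧ s.partner m ≠ -m := by grind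
  have q5 : s'.partner (-m) = m + 1 := by grind
  rw [q5] at q1
  have q6 : s.partner m = m - 1 ∧ i ≤ m - 1 := by
    unfold shift at q1
    grind
  refine hb (m - 1) q6.2 ?_ ?_
  · grind
  · have := s.deco_partner m
    grind

theorem IsShifted.injective {m i : ℤ} {s₁ s₂ s' : LinkState}
    (hm : 1 ≤ i) (hi : i ≤ m)
    (h₁ : s₁.IsVerticalAbove m) (h₂ : s₂.IsVerticalAbove m)
    (h₁' : IsShifted m i s₁ s') (h₂' : IsShifted m i s₂ s') : s₁ = s₂ := by
  have a1 := h₁ (m + 1) (by lia)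
  have a2 := h₂ (m + 1) (by lia)
  have b1 := s₁.partner_partner
  have b2 := s₂.partner_partner
  have c1 := s₁.deco_partner
  have c2 := s₂.deco_partner
  have inj : ∀ a b, a ≠ -m → b ≠ -m → a ≠ m + 1 → b ≠ m + 1 →
      shift m i a = shift m i b → a = b := by
    intro a b; unfold shift; grind
  ext a
  · by_cases h : a = m + 1 ∨ a = -m
    · grind
    · push Not at h
      have r1 := h₁'.partner_shift a h.1 h.2
      have r2 := h₂'.partner_shift a h.1 h.2
      refine inj _ _ ?_ ?_ ?_ ?_ (r1.symm.trans r2) <;> grind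
  · by_cases h : a = m + 1 ∨ a = -m
    · grind
    · push Not at h
      rw [← h₁'.deco_shift a h.1 h.2, ← h₂'.deco_shift a h.1 h.2]

theorem IsShifted.deco_lt {m i : ℤ} {s s' : LinkState} {d : ℕ} (hd : 0 < d)
    (hm : 1 ≤ i) (hi : i ≤ m) (h : ∀ a, s.deco a < d)
    (h' : IsShifted m i s s') (a : ℤ) : s'.deco a < d := by
  by_cases h1 : a = i ∨ a = i + 1
  · have := s'.deco_partner i
    have := h'.partner_cup
    have := h'.deco_cup
    grind
  · obtain ⟨c, hc, hc', rfl⟩ : ∃ c, c ≠ m + 1 ∧ c ≠ -m ∧ shift m i c = a := by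
      by_cases h2 : a = -m
      · exact ⟨m, by lia, by lia, by unfold shift; grind⟩
      by_cases h3 : i ≤ a ∧ a ≤ m + 1
      · exact ⟨a - 2, by lia, by lia, by unfold shift; grind⟩
      · exact ⟨a, by lia, by lia, by unfold shift; grind⟩
    rw [h'.deco_shift c hc hc']
    exact h c

theorem dot_injective (k : ℕ) : Function.Injective (dot k) := by
  intro s t h
  have h1 : (dot k s).partner = (dot k t).partner := congrArg partner h
  change s.partner = t.partner at h1
  have h2 : ∀ a, (s.dot k).deco a = (t.dot k).deco a := fun a => by rw [h]
  simp only [dot, setDeco] at h2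
  have h3 := s.deco_partner
  have h4 := t.deco_partner
  ext a
  · rw [h1]
  · have := h2 a
    have := h2 1
    grind

/-- The effect of `E_m E_{m-1} ⋯ E_{m-r+1}` on link states. -/
def joinDown (m : ℤ) : ℕ → LinkState → LinkState
  | 0, s => s
  | r + 1, s => (joinDown m r s).join (m - r)

theorem isShifted_joinDown {m : ℤ} {r : ℕ} (hr : 1 ≤ r) (hrm : r ≤ m) {s : LinkState}
    (hs : s.IsVerticalAbove m) : IsShifted m (m + 1 - r) s (joinDown m r s) := by
  induction r, hr using Nat.le_induction with
  | base =>
    simpa [joinDown] using hs.isShifted_join (by lia)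
  | succ r hr ih =>
    have := ih (by lia)
    have h := IsShifted.join (i := m - r) (by lia) (by lia) hs
      (by rwa [show m - r + 1 = m + 1 - r by ring])
    rwa [show m + 1 - ((r + 1 : ℕ) : ℤ) = m - r by push_cast; ring]

theorem loopWeight_joinDown (f : ℕ → ℂ) {m : ℤ} {r : ℕ} (hrm : r < m) {s : LinkState}
    (hs : s.IsVerticalAbove m) : (joinDown m r s).loopWeight f (m - r) = 1 := by
  have h1 := s.partner_partner
  rcases Nat.eq_zero_or_pos r with rfl | hr
  · have := hs (m + 1) (by lia)
    simp only [joinDown, loopWeight]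
    grind
  · have h2 := (isShifted_joinDown hr (by lia) hs).partner_cup
    have h1 := (joinDown m r s).partner_partner
    simp only [loopWeight]
    grind

end LinkState

/-- A letter of a standard monomial: the letter at level `m` contributes the factor `1`,
`E_{m,1} E_0^k` or `E_{m,j}`. -/
inductive Step
  | skip
  | dots (k : ℕ)
  | plain (j : ℕ)

namespace Step

/-- The normal words `w` with `j < b` for the topmost letter `plain j`. The head of a word is the
topmost letter, and its level is the length of the tail. -/
def IsNormal (d : ℕ) : ℕ → List Step → Prop
  | _, [] => True
  | b, skip :: w => IsNormal d b w
  | _, dots k :: w => (1 ≤ k ∧ k < d) ∧ IsNormal d 1 w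
  | b, plain j :: w => (1 ≤ j ∧ j < b ∧ j ≤ w.length) ∧ IsNormal d j w

/-- The link state obtained from `s` by the letter `a` at level `m`. -/
def applyStep (m : ℕ) (a : Step) (s : LinkState) : LinkState :=
  match a with
  | skip => s
  | dots k => (s.joinDown m m).dot k
  | plain j => s.joinDown m (m + 1 - j)

/-- The link state of the diagram of a word. -/
def wordState : List Step → LinkState
  | [] => LinkState.vertical
  | a :: w => applyStep w.length a (wordState w)

open LinkState

/-- The properties of the link states of normal words. -/
structure IsReached (d m b : ℕ) (s : LinkState) : Prop where
  isVerticalAbove : s.IsVerticalAbove m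
  noBareCup : s.NoBareCup b
  deco_lt : ∀ a, s.deco a < d

theorem isShifted_plain {m j : ℕ} (h1 : 1 ≤ j) (h2 : j ≤ m) {s : LinkState}
    (hs : s.IsVerticalAbove m) : IsShifted m j s (s.joinDown m (m + 1 - j)) := by
  have := isShifted_joinDown (m := m) (r := m + 1 - j) (by lia) (by lia) hs
  rwa [show (m : ℤ) + 1 - ((m + 1 - j : ℕ) : ℤ) = j by lia] at this

theorem isShifted_dots {m : ℕ} (h1 : 1 ≤ m) {s : LinkState}
    (hs : s.IsVerticalAbove m) : IsShifted m 1 s (s.joinDown m m) := by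
  simpa using isShifted_plain le_rfl h1 hs

theorem NoBareCup.mono {b c : ℤ} (hbc : b ≤ c) {s : LinkState} (h : s.NoBareCup b) :
    s.NoBareCup c := fun a ha => h a (hbc.trans ha)

theorem noBareCup_dot {k : ℕ} (hk : 1 ≤ k) {s : LinkState}
    (h : s.NoBareCup 2) : (s.dot k).NoBareCup 1 := by
  intro a ha hp
  have h1 := h a
  have h2 := s.deco_partner
  have h3 := s.partner_partner
  simp only [dot, setDeco] at hp ⊢
  grind

theorem IsReached.vertical {d : ℕ} (hd : 2 ≤ d) {b : ℕ} (hb : 1 ≤ b) :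
    IsReached d 0 b vertical := by
  refine ⟨fun a _ => ⟨rfl, rfl⟩, fun a ha h => ?_, fun a => ?_⟩
  · simp only [LinkState.vertical] at h
    lia
  · exact Nat.zero_lt_of_lt hd

theorem IsReached.plain {d m j b : ℕ} (h1 : 1 ≤ j) (h2 : j ≤ m) (hjb : j < b) {s : LinkState}
    (hd : 2 ≤ d) (hs : IsReached d m j s) :
    IsReached d (m + 1) b (s.joinDown m (m + 1 - j)) := by
  have h := isShifted_plain h1 h2 hs.isVerticalAbove
  have hj : (1 : ℤ) ≤ j := by lia
  have hm : (j : ℤ) ≤ m := by lia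
  refine ⟨?_, ?_, h.deco_lt (by lia) hj hm hs.deco_lt⟩
  · exact_mod_cast h.isVerticalAbove hj hm hs.isVerticalAbove
  · exact NoBareCup.mono (by lia) (h.noBareCup hj hm hs.isVerticalAbove hs.noBareCup)

theorem IsReached.joinDown_self {d m : ℕ} (hd : 2 ≤ d) {s : LinkState} (hs : IsReached d m 1 s) :
    IsReached d (m + 1) 2 (s.joinDown m m) := by
  rcases Nat.eq_zero_or_pos m with rfl | hm
  · exact ⟨fun a ha => hs.isVerticalAbove a (by lia), NoBareCup.mono (by lia) hs.noBareCup,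
      hs.deco_lt⟩
  · simpa using hs.plain le_rfl hm one_lt_two hd

theorem IsReached.mono {d m b c : ℕ} (hbc : b ≤ c) {s : LinkState} (hs : IsReached d m b s) :
    IsReached d m c s :=
  ⟨hs.isVerticalAbove, NoBareCup.mono (by lia) hs.noBareCup, hs.deco_lt⟩

theorem IsReached.joinDown_self_deco {d m : ℕ} {s : LinkState} (hs : IsReached d m 1 s) :
    (s.joinDown m m).deco 1 = 0 := by
  rcases Nat.eq_zero_or_pos m with rfl | hm
  · exact (hs.isVerticalAbove 1 (by lia)).2
  · exact (isShifted_dots hm hs.isVerticalAbove).deco_cup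

theorem IsReached.dots {d m k b : ℕ} (hd : 2 ≤ d) (hb : 1 ≤ b) (h1 : 1 ≤ k) (h2 : k < d)
    {s : LinkState} (hs : IsReached d m 1 s) :
    IsReached d (m + 1) b ((s.joinDown m m).dot k) := by
  have h := hs.joinDown_self hd
  have h0 := hs.joinDown_self_deco
  set t := s.joinDown m m
  have hp := t.partner_partner
  refine IsReached.mono hb ⟨fun a ha => ?_, ?_, fun a => ?_⟩
  · have hv := h.isVerticalAbove
    have := hv a ha
    have := hv
    have := hv (t.partner 1)
    simp only [dot, setDeco]
    grind
  · exact noBareCup_dot h1 h.noBareCup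
  · have := h.deco_lt a
    simp only [dot, setDeco]
    grind

theorem isReached_wordState {d b : ℕ} (hd : 2 ≤ d) (hb : 1 ≤ b) {w : List Step}
    (h : IsNormal d b w) : IsReached d w.length b (wordState w) := by
  induction w generalizing b with
  | nil => exact IsReached.vertical hd hb
  | cons a w ih =>
    cases a with
    | skip =>
      have := ih hb h
      exact ⟨fun a ha => this.isVerticalAbove a (by simp at ha; lia), this.noBareCup, this.deco_lt⟩
    | dots k => exact (ih le_rfl h.2).dots hd hb h.1.1 h.1.2
    | plain j => exact (ih h.1.1 h.2).plain h.1.1 h.1.2.2 h.1.2.1 hd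
theorem IsReached.partner_succ {d m b : ℕ} {s : LinkState} (hs : IsReached d m b s) :
    s.partner (m + 1) = -m ∧ s.deco (m + 1) = 0 := by
  obtain ⟨h1, h2⟩ := hs.isVerticalAbove (m + 1) (by lia)
  exact ⟨by rw [h1]; ring, h2⟩

theorem IsReached.plain_ne_skip {d m j : ℕ} (h1 : 1 ≤ j) (h2 : j ≤ m) {s : LinkState}
    (hs : IsReached d m j s) :
    ¬((s.joinDown m (m + 1 - j)).partner (m + 1) = -m ∧
      (s.joinDown m (m + 1 - j)).deco (m + 1) = 0) :=
  (isShifted_plain h1 h2 hs.isVerticalAbove).not_vertical (by lia) (by lia) hs.isVerticalAbove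
    hs.noBareCup

theorem IsReached.dots_ne_skip {d m k : ℕ} (h1 : 1 ≤ k) {s : LinkState}
    (hs : IsReached d m 1 s) :
    ¬(((s.joinDown m m).dot k).partner (m + 1) = -m ∧
      ((s.joinDown m m).dot k).deco (m + 1) = 0) := by
  rcases Nat.eq_zero_or_pos m with rfl | hm
  · simp only [dot, setDeco]
    simp
    lia
  · have := hs.plain_ne_skip le_rfl hm
    rw [Nat.add_sub_cancel] at this
    simp only [dot, setDeco]
    grind

theorem deco_dot_one (k : ℕ) (s : LinkState) : (s.dot k).deco 1 = s.deco 1 + k := by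
  simp [dot, setDeco]

theorem IsReached.lt_of_noBareCup {d m j c : ℕ} (h1 : 1 ≤ j) (h2 : j ≤ m) {s : LinkState}
    (hs : IsReached d m j s) (hc : (s.joinDown m (m + 1 - j)).NoBareCup c) : j < c := by
  have h3 := isShifted_plain h1 h2 hs.isVerticalAbove
  by_contra h4
  exact hc j (by lia) h3.partner_cup h3.deco_cup

theorem IsReached.dots_ne_plain {d m k j : ℕ} (hd : 2 ≤ d) (hk : 1 ≤ k ∧ k < d) (h1 : 1 ≤ j)
    (h2 : j ≤ m) {s t : LinkState} (hs : IsReached d m 1 s) (ht : IsReached d m j t) :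
    (s.joinDown m m).dot k ≠ t.joinDown m (m + 1 - j) := by
  intro h
  have h3 := (hs.dots hd le_rfl hk.1 hk.2).noBareCup
  rw [h] at h3
  have := ht.lt_of_noBareCup h1 h2 h3
  lia

theorem wordState_injective {d b : ℕ} (hd : 2 ≤ d) (hb : 1 ≤ b) {v w : List Step}
    (hv : IsNormal d b v) (hw : IsNormal d b w) (hl : v.length = w.length)
    (h : wordState v = wordState w) : v = w := by
  induction v generalizing b w with
  | nil => exact (List.length_eq_zero_iff.1 hl.symm).symm
  | cons x v ih =>
    obtain _ | ⟨y, w⟩ := w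
    · simp at hl
    have hl' : v.length = w.length := by simpa using hl
    have reach : ∀ {c}, 1 ≤ c → IsNormal d c v → IsReached d w.length c (wordState v) :=
      fun hc hv => hl' ▸ isReached_wordState hd hc hv
    rcases x with _ | k | j <;> rcases y with _ | l | i <;>
      simp only [wordState, applyStep, hl'] at h <;> simp only [IsNormal, hl'] at hv hw
    · rw [ih hb hv hw hl' h]
    · exact ((isReached_wordState hd le_rfl hw.2).dots_ne_skip hw.1.1
        (h ▸ (reach hb hv).partner_succ)).elim
    · exact ((isReached_wordState hd hw.1.1 hw.2).plain_ne_skip hw.1.1 hw.1.2.2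
        (h ▸ (reach hb hv).partner_succ)).elim
    · exact ((reach le_rfl hv.2).dots_ne_skip hv.1.1
        (h ▸ (isReached_wordState hd hb hw).partner_succ)).elim
    · have rv := reach le_rfl hv.2
      have rw := isReached_wordState hd le_rfl hw.2
      have hkl := congrArg (fun s => deco s 1) h
      simp only [deco_dot_one, rv.joinDown_self_deco, rw.joinDown_self_deco, zero_add] at hkl
      subst hkl
      have h' := dot_injective k h
      refine congrArg _ (ih le_rfl hv.2 hw.2 hl' ?_)
      rcases Nat.eq_zero_or_pos w.length with h0 | h0
      · rwa [h0] at h'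
      · exact IsShifted.injective le_rfl (by lia) rv.isVerticalAbove rw.isVerticalAbove
          (isShifted_dots h0 rv.isVerticalAbove) (h' ▸ isShifted_dots h0 rw.isVerticalAbove)
    · exact ((reach le_rfl hv.2).dots_ne_plain hd hv.1 hw.1.1 hw.1.2.2
        (isReached_wordState hd hw.1.1 hw.2) h).elim
    · exact ((reach hv.1.1 hv.2).plain_ne_skip hv.1.1 hv.1.2.2
        (h ▸ (isReached_wordState hd hb hw).partner_succ)).elim
    · exact ((isReached_wordState hd le_rfl hw.2).dots_ne_plain hd hw.1 hv.1.1 hv.1.2.2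
        (reach hv.1.1 hv.2) h.symm).elim
    · have rv := reach hv.1.1 hv.2
      have rw := isReached_wordState hd hw.1.1 hw.2
      have h1 := (rv.plain (b := j + 1) hv.1.1 hv.1.2.2 (by lia) hd).noBareCup
      have h2 := (rw.plain (b := i + 1) hw.1.1 hw.1.2.2 (by lia) hd).noBareCup
      have h3 := rw.lt_of_noBareCup hw.1.1 hw.1.2.2 (h ▸ h1)
      have h4 := rv.lt_of_noBareCup hv.1.1 hv.1.2.2 (h ▸ h2)
      obtain rfl : i = j := by lia
      refine congrArg _ (ih hw.1.1 hv.2 hw.2 hl' ?_)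
      exact IsShifted.injective (by lia) (by lia) rv.isVerticalAbove rw.isVerticalAbove
        (isShifted_plain hv.1.1 hv.1.2.2 rv.isVerticalAbove)
        (h ▸ isShifted_plain hw.1.1 hw.1.2.2 rw.isVerticalAbove)

end Step

/-- The coefficient of the state `r` in link states; it is supported on the states whose
decorations vanish outside `S`. -/
noncomputable def coeffFun (d : ℕ) (c : ℂ) (S : Finset ℤ) (r s : LinkState) : ℂ :=
  open Classical in
  if s.partner = r.partner ∧ ∀ a, a ∉ S → a < s.partner a → s.deco a = 0 then
    ∏ a ∈ S.filter fun a => a < r.partner a,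
      extendDeco d c (fun k => if k = r.deco a then 1 else 0) (s.deco a)
  else 0

theorem coeffFun_mem {d : ℕ} (hd : 2 ≤ d) (c : ℂ) (S : Finset ℤ) (r : LinkState) :
    coeffFun d c S r ∈ dotReduced d c := by
  classical
  have low : ∀ s p v, 1 ≤ v → p < s.partner p →
      coeffFun d c S r (LinkState.setDeco p (v + (d - 1)) s) =
        c * coeffFun d c S r (LinkState.setDeco p v s) := by
    intro s p v hv hp
    have hdeco : ∀ v a, a < s.partner a →
        (s.setDeco p v).deco a = if a = p then v else s.deco a := by
      intro v a ha
      have := s.partner_partner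
      simp only [LinkState.setDeco]
      grind
    unfold coeffFun
    by_cases hpS : p ∈ S
    · have hiff : ∀ v, ((s.setDeco p v).partner = r.partner ∧
          ∀ a, a ∉ S → a < (s.setDeco p v).partner a → (s.setDeco p v).deco a = 0) ↔
          (s.partner = r.partner ∧ ∀ a, a ∉ S → a < s.partner a → s.deco a = 0) := by
        intro v
        refine and_congr Iff.rfl (forall_congr' fun a => imp_congr_right fun haS =>
          imp_congr_right fun ha => ?_)
        rw [hdeco v a ha, if_neg (by rintro rfl; exact haS hpS)]
      rw [if_congr (hiff _) rfl rfl, if_congr (hiff _) rfl rfl]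
      split_ifs with h
      · have hpm : p ∈ S.filter fun a => a < r.partner a := by simp [hpS, ← h.1, hp]
        rw [← Finset.mul_prod_erase _ _ hpm, ← Finset.mul_prod_erase _ _ hpm, hdeco _ _ hp,
          hdeco _ _ hp, if_pos rfl, if_pos rfl, extendDeco_add hd _ _ hv, mul_assoc]
        refine congrArg _ (congrArg _ (Finset.prod_congr rfl fun a ha => ?_))
        simp only [Finset.mem_erase, Finset.mem_filter, ← h.1] at ha
        rw [hdeco _ _ ha.2.2, hdeco _ _ ha.2.2, if_neg ha.1, if_neg ha.1]
      · rw [mul_zero]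
    · have hneg : ∀ v, 1 ≤ v → ¬((s.setDeco p v).partner = r.partner ∧
          ∀ a, a ∉ S → a < (s.setDeco p v).partner a → (s.setDeco p v).deco a = 0) := by
        rintro v hv ⟨-, h⟩
        have := h p hpS hp
        rw [hdeco v p hp, if_pos rfl] at this
        omega
      rw [if_neg (hneg _ (by omega)), if_neg (hneg _ hv), mul_zero]
  intro s p v hv
  rcases lt_or_gt_of_ne (s.partner_ne p) with h | h
  · rw [← LinkState.setDeco_partner p, ← LinkState.setDeco_partner p]
    exact low s _ v hv (by rwa [s.partner_partner])
  · exact low s p v hv h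

theorem coeffFun_apply {d : ℕ} (c : ℂ) {S : Finset ℤ} {r s : LinkState}
    (hs : ∀ a, s.deco a < d)
    (hrS : ∀ a, a ∉ S → a < r.partner a → r.deco a = 0)
    (hsS : ∀ a, a ∉ S → a < s.partner a → s.deco a = 0) [Decidable (r = s)] :
    coeffFun d c S r s = if r = s then 1 else 0 := by
  classical
  unfold coeffFun
  split_ifs with h1 h2 h2
  · subst h2
    refine Finset.prod_eq_one fun a _ => ?_
    rw [extendDeco_of_lt _ _ (hs a), if_pos rfl]
  · obtain ⟨a, ha, hne⟩ : ∃ a, a < r.partner a ∧ s.deco a ≠ r.deco a := by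
      by_contra! hall
      refine h2 (LinkState.ext h1.1.symm (funext fun a => ?_))
      rcases lt_or_gt_of_ne (r.partner_ne a) with h | h
      · have := hall (r.partner a) (by rwa [r.partner_partner])
        rw [r.deco_partner, ← h1.1, s.deco_partner] at this
        exact this.symm
      · exact (hall a h).symm
    have haS : a ∈ S := by
      by_contra haS
      exact hne ((hsS a haS (by rwa [h1.1])).trans (hrS a haS ha).symm)
    refine Finset.prod_eq_zero (Finset.mem_filter.2 ⟨haS, ha⟩) ?_
    rw [extendDeco_of_lt _ _ (hs a), if_neg hne]
  · subst h2
    exact absurd ⟨rfl, hsS⟩ h1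
  · rfl

theorem Edec_of_lt (d n : ℕ) (δ : ℂ) {i j : ℕ} (h : i < j) : Edec d n δ i j = 1 := by
  rw [Edec, Nat.sub_eq_zero_of_le h]
  rfl

theorem Edec_eq_mul (d n : ℕ) (δ : ℂ) {i j : ℕ} (h : j ≤ i) :
    Edec d n δ i j = Edec d n δ i (j + 1) * Egen d n δ j := by
  rw [Edec, Edec, show i + 1 - j = i + 1 - (j + 1) + 1 by omega, List.range'_succ]
  simp

theorem Einc_eq_mul (d n : ℕ) (δ : ℂ) {i j : ℕ} (h : i ≤ j) :
    Einc d n δ i j = Egen d n δ i * Einc d n δ (i + 1) j := by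
  rw [Einc, Einc, show j + 1 - i = j + 1 - (i + 1) + 1 by omega, List.range'_succ]
  simp

theorem Einc_succ (d n : ℕ) (δ : ℂ) {i j : ℕ} (h : i ≤ j + 1) :
    Einc d n δ i (j + 1) = Einc d n δ i j * Egen d n δ (j + 1) := by
  rw [Einc, Einc, show j + 1 + 1 - i = j + 1 - i + 1 by omega, List.range'_concat]
  simp [show i + (j + 1 - i) = j + 1 by omega]

theorem Einc_of_lt (d n : ℕ) (δ : ℂ) {i j : ℕ} (h : i < j) : Einc d n δ j i = 1 := by
  rw [Einc, Nat.sub_eq_zero_of_le h]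
  rfl

namespace Step

/-- The factor of a standard monomial given by a letter at level `m`. -/
noncomputable def stepMon (d n : ℕ) (δ : ℂ) (m : ℕ) : Step → TL d n δ
  | skip => 1
  | dots k => Edec d n δ m 1 * Egen d n δ 0 ^ k
  | plain j => Edec d n δ m j

/-- The standard monomial of type (i) or (ii) given by a word. -/
noncomputable def mon (d n : ℕ) (δ : ℂ) : List Step → TL d n δ
  | [] => 1
  | a :: w => mon d n δ w * stepMon d n δ w.length a

/-- The word has no letter `dots k`. -/
def IsPlain (w : List Step) : Prop := ∀ k, dots k ∉ w

/-- The standard monomial of type (iii) given by a word without letters `dots k`, not all of whose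
letters are `skip`. -/
noncomputable def monThree (d n : ℕ) (δ : ℂ) : List Step → TL d n δ
  | [] => 1
  | skip :: w => monThree d n δ w
  | dots _ :: _ => 0
  | plain j :: w =>
    open Classical in
    if ∀ a ∈ w, a = skip then
      Edec d n δ w.length 1 * Egen d n δ 0 * Einc d n δ 1 j
    else monThree d n δ w * Edec d n δ w.length j

section

variable {d n : ℕ} {hd : 2 ≤ d} {δ : ℂ} {e : Module.End ℂ (LinkModule d δ)}
  {φ : TL d n δ →ₐ[ℂ] Module.End ℂ (LinkModule d δ)}

theorem apply_Edec (hφ : ∀ i < n, φ (Egen d n δ i) = genEnd hd δ e i) {m r : ℕ} (hm : m < n)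
    (hr : r ≤ m) (F : LinkModule d δ) {s : LinkState} (hs : s.IsVerticalAbove m) :
    (φ (Edec d n δ m (m + 1 - r)) F).1 s = F.1 (s.joinDown m r) := by
  induction r generalizing F with
  | zero =>
    rw [Nat.sub_zero, Edec_of_lt d n δ (Nat.lt_succ_self m), map_one]
    rfl
  | succ r ih =>
    rw [Edec_eq_mul d n δ (by omega), map_mul, Module.End.mul_apply,
      show m + 1 - (r + 1) + 1 = m + 1 - r by omega, ih (by omega), hφ _ (by omega), genEnd,
      if_neg (by omega), joinEnd_apply, show ((m + 1 - (r + 1) : ℕ) : ℤ) = m - r by lia,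
      LinkState.loopWeight_joinDown _ (by lia) hs, one_mul]
    rfl

theorem apply_mon (hφ : ∀ i < n, φ (Egen d n δ i) = genEnd hd δ e i) {w : List Step} {b : ℕ}
    (hb : 1 ≤ b) (hw : IsNormal d b w) (hl : w.length ≤ n) (he : e = dotEnd δ ∨ IsPlain w)
    (F : LinkModule d δ) : (φ (mon d n δ w) F).1 LinkState.vertical = F.1 (wordState w) := by
  induction w generalizing b F with
  | nil => rw [mon, map_one]; rfl
  | cons a w ih =>
    rw [List.length_cons] at hl
    have he' : e = dotEnd δ ∨ IsPlain w :=
      he.imp_right fun h k hk => h k (List.mem_cons_of_mem _ hk)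
    rw [mon, map_mul, Module.End.mul_apply]
    cases a with
    | skip =>
      rw [ih hb hw (by omega) he', stepMon, map_one]
      rfl
    | dots k =>
      obtain rfl : e = dotEnd δ := he.resolve_right fun h => h k List.mem_cons_self
      have hs := (isReached_wordState hd le_rfl hw.2).isVerticalAbove
      have := apply_Edec hφ (m := w.length) (by omega) le_rfl (φ (Egen d n δ 0 ^ k) F) hs
      rw [Nat.add_sub_cancel_left] at this
      rw [ih le_rfl hw.2 (by omega) he', stepMon, map_mul, Module.End.mul_apply, this, map_pow,
        hφ 0 (by omega), genEnd, if_pos rfl, dotEnd_pow_apply]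
      rfl
    | plain j =>
      have hs := (isReached_wordState hd hw.1.1 hw.2).isVerticalAbove
      have hj := hw.1
      have := apply_Edec hφ (m := w.length) (r := w.length + 1 - j) (by omega) (by omega) F hs
      rw [show w.length + 1 - (w.length + 1 - j) = j by omega] at this
      rw [ih hw.1.1 hw.2 (by omega) he', stepMon, this]
      rfl

theorem map_mon_eq_zero (hφ : ∀ i < n, φ (Egen d n δ i) = genEnd hd δ 0 i) {w : List Step} {b : ℕ}
    (hw : IsNormal d b w) (hl : w.length ≤ n) (h : ¬IsPlain w) : φ (mon d n δ w) = 0 := by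
  induction w generalizing b with
  | nil => exact absurd (fun k => List.not_mem_nil) h
  | cons a w ih =>
    rw [List.length_cons] at hl
    rw [mon, map_mul]
    have hw' : ∀ c, IsNormal d c w → (∀ k, a ≠ dots k) →
        φ (mon d n δ w) * φ (stepMon d n δ w.length a) = 0 := by
      intro c hc ha
      rw [ih hc (by omega), zero_mul]
      intro h'
      refine h fun k hk => ?_
      rcases List.mem_cons.1 hk with rfl | hk
      · exact ha k rfl
      · exact h' k hk
    cases a with
    | skip => exact hw' b hw (by simp)
    | dots k =>
      rw [stepMon, map_mul, map_pow, hφ 0 (by omega), genEnd, if_pos rfl,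
        zero_pow (by have := hw.1.1; omega), mul_zero, mul_zero]
    | plain j => exact hw' j hw.2 (by simp)

theorem map_Edec_one_mul_Einc (hφ : ∀ i < n, φ (Egen d n δ i) = genEnd hd δ e i) {m j : ℕ}
    (hm : m < n) (h1 : 1 ≤ j) (h2 : j ≤ m) :
    φ (Edec d n δ m 1 * Einc d n δ 2 j) = φ (Edec d n δ m j) := by
  induction j, h1 using Nat.le_induction with
  | base => rw [Einc_of_lt d n δ one_lt_two, mul_one]
  | succ j hj ih =>
    rw [Einc_succ d n δ (by omega), ← mul_assoc, map_mul, ih (by omega),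
      Edec_eq_mul d n δ (show j ≤ m by omega), Edec_eq_mul d n δ h2, map_mul, map_mul, mul_assoc,
      mul_assoc, ← mul_assoc (φ (Egen d n δ (j + 1))), hφ _ (by omega), hφ _ (by omega), genEnd,
      genEnd, if_neg (by omega), if_neg (by omega), Nat.cast_add, Nat.cast_one,
      joinEnd_succ_mul_mul_succ]

theorem mon_eq_one {w : List Step} (h : ∀ a ∈ w, a = skip) : mon d n δ w = 1 := by
  induction w with
  | nil => rfl
  | cons a w ih =>
    rw [mon, ih fun a ha => h a (List.mem_cons_of_mem _ ha), h a List.mem_cons_self, stepMon,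
      mul_one]

theorem map_Edec_mul_mul_Einc (hφ : ∀ i < n, φ (Egen d n δ i) = genEnd hd δ (dotEnd δ) i) {m j : ℕ}
    (hm : m < n) (h1 : 1 ≤ j) (h2 : j ≤ m) :
    φ (Edec d n δ m 1 * Egen d n δ 0 * Einc d n δ 1 j) = (2 : ℂ) • φ (Edec d n δ m j) := by
  have h := joinEnd_mul_dotEnd_pow_mul hd δ (k := 1) le_rfl (by omega)
  rw [← map_Edec_one_mul_Einc hφ hm h1 h2, Edec_eq_mul d n δ (show 1 ≤ m by omega),
    Einc_eq_mul d n δ h1]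
  simp only [map_mul, hφ 0 (show 0 < n by omega), hφ 1 (show 1 < n by omega), genEnd, if_pos,
    if_neg one_ne_zero, Nat.cast_one]
  rw [pow_one, Nat.cast_one, one_add_one_eq_two] at h
  rw [mul_assoc (φ _) _ (dotEnd δ), mul_assoc (φ _), ← mul_assoc _ _ (φ _), h, smul_mul_assoc,
    mul_smul_comm, mul_assoc (φ _)]

theorem map_monThree (hφ : ∀ i < n, φ (Egen d n δ i) = genEnd hd δ (dotEnd δ) i) {w : List Step}
    {b : ℕ} (hw : IsNormal d b w) (hl : w.length ≤ n) (hp : IsPlain w) (h : ¬∀ a ∈ w, a = skip) :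
    φ (monThree d n δ w) = (2 : ℂ) • φ (mon d n δ w) := by
  induction w generalizing b with
  | nil => simp at h
  | cons a w ih =>
    rw [List.length_cons] at hl
    have hp' : IsPlain w := fun k hk => hp k (List.mem_cons_of_mem _ hk)
    cases a with
    | skip =>
      rw [monThree, ih hw (by omega) hp' fun h' => h (by simpa using h'), mon, stepMon, mul_one]
    | dots k => exact absurd List.mem_cons_self (hp k)
    | plain j =>
      rw [monThree]
      split_ifs with h'
      · rw [map_Edec_mul_mul_Einc hφ (by omega) hw.1.1 hw.1.2.2, mon, mon_eq_one h', one_mul,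
          stepMon]
      · rw [map_mul, ih hw.2 (by omega) hp' h', mon, map_mul, smul_mul_assoc, stepMon]

theorem map_monThree_eq_zero (hφ : ∀ i < n, φ (Egen d n δ i) = genEnd hd δ 0 i) {w : List Step}
    (hl : w.length ≤ n) (h : ¬∀ a ∈ w, a = skip) :
    φ (monThree d n δ w) = 0 := by
  induction w with
  | nil => simp at h
  | cons a w ih =>
    rw [List.length_cons] at hl
    cases a with
    | skip => rw [monThree, ih (by omega) fun h' => h (by simpa using h')]
    | dots k => rw [monThree, map_zero]
    | plain j =>
      rw [monThree]
      split_ifs with h'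
      · rw [map_mul, map_mul, hφ 0 (by omega), genEnd, if_pos rfl, mul_zero, zero_mul]
      · rw [map_mul, ih (by omega) h', zero_mul]

end

end Step

namespace Step

/-- The sum of the exponents of `E_0` in a word. -/
def dotSum : List Step → ℕ
  | [] => 0
  | skip :: w => dotSum w
  | dots k :: w => dotSum w + k
  | plain _ :: w => dotSum w

/-- The words of the standard monomials of types (i) and (ii) in `𝒯(d,d,n)`. -/
def wordsTwo (d n : ℕ) : Set (List Step) :=
  {w | w.length = n ∧ IsNormal d n w ∧ dotSum w % d = 0}

/-- The words of the standard monomials of type (iii) in `𝒯(d,d,n)`. -/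
def wordsThree (d n : ℕ) : Set (List Step) :=
  {w | w.length = n ∧ IsNormal d n w ∧ IsPlain w ∧ ¬∀ a ∈ w, a = skip}

theorem IsReached.deco_eq_zero {d n b : ℕ} {s : LinkState} (hs : IsReached d n b s) {a : ℤ}
    (ha : a ∉ Finset.Icc (-n : ℤ) n) : s.deco a = 0 := by
  rw [Finset.mem_Icc, not_and_or, not_le, not_le] at ha
  rcases ha with ha | ha
  · obtain ⟨h1, h2⟩ := hs.isVerticalAbove (1 - a) (by lia)
    rw [← h2, ← s.deco_partner (1 - a), h1]
    congr 1
    ring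
  · exact (hs.isVerticalAbove a ha).2

/-- The linear functional on `𝒯(d,n)` given by the coefficient of a link state in a
representation. -/
noncomputable def coeffDual {d : ℕ} {A : Type*} [Ring A] [Algebra ℂ A] {δ : ℂ} (hd : 2 ≤ d) (n : ℕ)
    (φ : A →ₐ[ℂ] Module.End ℂ (LinkModule d δ)) (r : LinkState) : Module.Dual ℂ A where
  toFun x := (φ x ⟨coeffFun d _ (Finset.Icc (-n : ℤ) n) r, coeffFun_mem hd _ _ r⟩).1
    LinkState.vertical
  map_add' x y := by rw [map_add]; rfl
  map_smul' a x := by rw [map_smul]; rfl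

section

variable {d n : ℕ} {hd : 2 ≤ d} {δ : ℂ} {e : Module.End ℂ (LinkModule d δ)}
  {φ : TL d n δ →ₐ[ℂ] Module.End ℂ (LinkModule d δ)}

open Classical in
theorem coeffDual_mon (hn : 1 ≤ n) (hφ : ∀ i < n, φ (Egen d n δ i) = genEnd hd δ e i)
    {v w : List Step} (hv : v.length = n) (hvn : IsNormal d n v) (hw : w.length = n)
    (hwn : IsNormal d n w) (he : e = dotEnd δ ∨ IsPlain w) :
    coeffDual hd n φ (wordState v) (mon d n δ w) = if v = w then 1 else 0 := by
  have rv := hv ▸ isReached_wordState hd hn hvn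
  have rw := hw ▸ isReached_wordState hd hn hwn
  refine (apply_mon hφ hn hwn hw.le he _).trans ?_
  refine (coeffFun_apply _ rw.deco_lt (fun _ h _ => rv.deco_eq_zero h)
    fun _ h _ => rw.deco_eq_zero h).trans ?_
  exact if_congr ⟨wordState_injective hd hn hvn hwn (hv.trans hw.symm), congrArg _⟩ rfl rfl

end

theorem linearIndependent_mon {d n : ℕ} (hd : 2 ≤ d) (hn : 1 ≤ n) (δ : ℂ) :
    LinearIndependent ℂ (Sum.elim (fun w : wordsTwo d n => mon d n δ w)
      (fun w : wordsThree d n => monThree d n δ w)) := by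
  classical
  obtain ⟨φ, hφ⟩ := exists_representation hd δ n (dotEnd δ) (Or.inl rfl)
  obtain ⟨ψ, hψ⟩ := exists_representation hd δ n 0 (Or.inr rfl)
  let f : wordsTwo d n ⊕ wordsThree d n → Module.Dual ℂ (TL d n δ) :=
    Sum.elim (fun w => coeffDual hd n (if IsPlain w.1 then ψ else φ) (wordState w))
      (fun w => (1 / 2 : ℂ) • (coeffDual hd n φ (wordState w) - coeffDual hd n ψ (wordState w)))
  have h3 : ∀ (w : wordsThree d n) r, coeffDual hd n φ r (monThree d n δ w) =
      2 * coeffDual hd n φ r (mon d n δ w) := by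
    rintro ⟨w, hl, hw, hp, hs⟩ r
    simp only [coeffDual, LinearMap.coe_mk, AddHom.coe_mk, map_monThree hφ hw hl.le hp hs]
    rfl
  have h3' : ∀ (w : wordsThree d n) r, coeffDual hd n ψ r (monThree d n δ w) = 0 := by
    rintro ⟨w, hl, hw, hp, hs⟩ r
    simp only [coeffDual, LinearMap.coe_mk, AddHom.coe_mk, map_monThree_eq_zero hψ hl.le hs]
    rfl
  have h2' : ∀ (w : List Step) r, w.length = n → IsNormal d n w → ¬IsPlain w →
      coeffDual hd n ψ r (mon d n δ w) = 0 := by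
    intro w r hl hw hp
    simp only [coeffDual, LinearMap.coe_mk, AddHom.coe_mk, map_mon_eq_zero hψ hw hl.le hp]
    rfl
  have key : ∀ i j, f i (Sum.elim (fun w : wordsTwo d n => mon d n δ w)
      (fun w : wordsThree d n => monThree d n δ w) j) = if i = j then 1 else 0 := by
    have hφ2 : ∀ {v w : List Step}, v.length = n → IsNormal d n v → w.length = n →
        IsNormal d n w → coeffDual hd n φ (wordState v) (mon d n δ w) = if v = w then 1 else 0 :=
      fun hv hvn hw hwn => coeffDual_mon hn hφ hv hvn hw hwn (Or.inl rfl)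
    have hψ2 : ∀ {v w : List Step}, v.length = n → IsNormal d n v → w.length = n →
        IsNormal d n w → IsPlain v →
        coeffDual hd n ψ (wordState v) (mon d n δ w) = if v = w then 1 else 0 := by
      intro v w hv hvn hw hwn hp
      by_cases hwp : IsPlain w
      · exact coeffDual_mon hn hψ hv hvn hw hwn (Or.inr hwp)
      · rw [h2' w _ hw hwn hwp, if_neg (by rintro rfl; exact hwp hp)]
    rintro (⟨v, hvl, hv, hv0⟩ | ⟨v, hvl, hv, hvp, hvs⟩) (⟨w, hwl, hw, hw0⟩ | ⟨w, hwl, hw, hwp, hws⟩)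
    · simp only [f, Sum.elim_inl, Sum.inl.injEq]
      by_cases h : IsPlain v
      · rw [if_pos h, hψ2 hvl hv hwl hw h]
        exact if_congr Subtype.mk_eq_mk.symm rfl rfl
      · rw [if_neg h, hφ2 hvl hv hwl hw]
        exact if_congr Subtype.mk_eq_mk.symm rfl rfl
    · simp only [f, Sum.elim_inl, Sum.elim_inr, reduceCtorEq, if_false]
      by_cases h : IsPlain v
      · rw [if_pos h, h3' ⟨w, hwl, hw, hwp, hws⟩]
      · rw [if_neg h, h3 ⟨w, hwl, hw, hwp, hws⟩, hφ2 hvl hv hwl hw,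
          if_neg (by rintro rfl; exact h hwp), mul_zero]
    · simp only [f, Sum.elim_inl, Sum.elim_inr, reduceCtorEq, if_false, LinearMap.smul_apply,
        LinearMap.sub_apply]
      rw [hφ2 hvl hv hwl hw, hψ2 hvl hv hwl hw hvp, sub_self, smul_zero]
    · simp only [f, Sum.elim_inr, Sum.inr.injEq, LinearMap.smul_apply,
        LinearMap.sub_apply]
      rw [h3 ⟨w, hwl, hw, hwp, hws⟩, h3' ⟨w, hwl, hw, hwp, hws⟩, hφ2 hvl hv hwl hw]
      refine Eq.trans ?_ (if_congr (P := v = w) Subtype.mk_eq_mk.symm rfl rfl)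
      split_ifs <;> simp
  refine LinearIndependent.of_pairwise_dual_eq_zero_one _ f (fun i j hij => ?_) fun i => ?_
  · change f i _ = 0
    rw [key, if_neg hij]
  · rw [key, if_pos rfl]

end Step

namespace Step

/-- The pairs `(i, k)` for the factors `E_{i,1} E_0^k` of a word. -/
def dotPart : List Step → List (ℕ × ℕ)
  | [] => []
  | skip :: w => dotPart w
  | dots k :: w => dotPart w ++ [(w.length, k)]
  | plain _ :: w => dotPart w

/-- The pairs `(i, j)` for the factors `E_{i,j}` of a word. -/
def plainPart : List Step → List (ℕ × ℕ)
  | [] => []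
  | skip :: w => plainPart w
  | dots _ :: w => plainPart w
  | plain j :: w => plainPart w ++ [(w.length, j)]

/-- The pairs of lists that come from the words of length `m` with `IsNormal d b`. -/
structure IsPairing (d m b : ℕ) (A B : List (ℕ × ℕ)) : Prop where
  pairwise_dots : A.Pairwise fun x y => x.1 < y.1
  pairwise_plain : B.Pairwise fun x y => x.1 < y.1 ∧ x.2 < y.2
  dots_lt_plain : ∀ x ∈ A, ∀ y ∈ B, x.1 < y.1
  dots_mem : ∀ x ∈ A, x.1 < m ∧ 1 ≤ x.2 ∧ x.2 < d
  plain_mem : ∀ y ∈ B, y.1 < m ∧ 1 ≤ y.2 ∧ y.2 ≤ y.1 ∧ y.2 < b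

theorem IsPairing.eq_nil {d m : ℕ} {A B : List (ℕ × ℕ)} (h : IsPairing d m 1 A B) : B = [] :=
  List.eq_nil_iff_forall_not_mem.2 fun y hy => by have := h.plain_mem y hy; omega

theorem isPairing_of_isNormal {d b : ℕ} {w : List Step} (h : IsNormal d b w) :
    IsPairing d w.length b (dotPart w) (plainPart w) := by
  induction w generalizing b with
  | nil => constructor <;> simp [dotPart, plainPart]
  | cons a w ih =>
    rcases a with _ | k | j
    · have := ih h
      exact ⟨this.1, this.2, this.3, fun x hx => (this.4 x hx).imp_left (Nat.lt_succ_of_lt ·),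
        fun x hx => (this.5 x hx).imp_left (Nat.lt_succ_of_lt ·)⟩
    · have h1 := ih h.2
      have h2 := h1.eq_nil
      have h3 := h.1
      have h4 := h1.dots_mem
      have h5 := h1.pairwise_dots
      constructor <;> simp only [dotPart, plainPart, h2, List.pairwise_append, List.mem_append,
        List.mem_singleton, List.length_cons] <;> grind
    · have h1 := ih h.2
      have h3 := h.1
      have h4 := h1.dots_mem
      have h5 := h1.pairwise_dots
      have h6 := h1.plain_mem
      have h7 := h1.pairwise_plain
      have h8 := h1.dots_lt_plain
      constructor <;> simp only [dotPart, plainPart, List.pairwise_append, List.mem_append,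
        List.mem_singleton, List.length_cons] <;> grind

theorem exists_isNormal {d b : ℕ} (hb : 1 ≤ b) (m : ℕ) {A B : List (ℕ × ℕ)}
    (h : IsPairing d m b A B) :
    ∃ w : List Step, w.length = m ∧ IsNormal d b w ∧ dotPart w = A ∧ plainPart w = B := by
  induction m generalizing b A B with
  | zero =>
    have hA : A = [] := List.eq_nil_iff_forall_not_mem.2 fun y hy => by
      have := h.dots_mem y hy; omega
    have hB : B = [] := List.eq_nil_iff_forall_not_mem.2 fun y hy => by
      have := h.plain_mem y hy; omega
    exact ⟨[], rfl, trivial, hA.symm, hB.symm⟩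
  | succ m ih =>
    have skip_case : (∀ x ∈ A, x.1 < m) → (∀ x ∈ B, x.1 < m) →
        ∃ w : List Step, w.length = m + 1 ∧ IsNormal d b w ∧ dotPart w = A ∧ plainPart w = B := by
      intro hA hB
      obtain ⟨w, hl, hw, h1, h2⟩ := ih hb ⟨h.1, h.2, h.3,
        fun x hx => ⟨hA x hx, (h.4 x hx).2⟩, fun x hx => ⟨hB x hx, (h.5 x hx).2⟩⟩
      exact ⟨skip :: w, by simp [hl], hw, h1, h2⟩
    obtain ⟨h1, h2, h3, h4, h5⟩ := h
    rcases B.eq_nil_or_concat' with rfl | ⟨B, ⟨i, j⟩, rfl⟩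
    · rcases A.eq_nil_or_concat' with rfl | ⟨A, ⟨i, k⟩, rfl⟩
      · exact skip_case (by simp) (by simp)
      · simp only [List.pairwise_append, List.mem_append, List.mem_singleton] at h1 h2 h3 h4 h5
        by_cases him : i = m
        · subst him
          obtain ⟨w, hl, hw, e1, e2⟩ := ih (b := 1) (A := A) (B := []) le_rfl
            ⟨h1.1, List.Pairwise.nil, by grind, by grind, by grind⟩
          exact ⟨dots k :: w, by simp [hl], ⟨(h4 (i, k) (Or.inr rfl)).2, hw⟩,
            by rw [dotPart, e1, hl], e2⟩
        · have h4 := (h4 (i, k) (Or.inr rfl)).1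
          have h1 : ∀ x ∈ A, x.1 < i := fun x hx => h1.2.2 x hx _ rfl
          exact skip_case (by grind) (by simp)
    · simp only [List.pairwise_append, List.mem_append, List.mem_singleton] at h1 h2 h3 h4 h5
      have hij := h5 (i, j) (Or.inr rfl)
      have hA : ∀ x ∈ A, x.1 < i := fun x hx => h3 x hx _ (Or.inr rfl)
      have hB : ∀ x ∈ B, x.1 < i ∧ x.2 < j := fun x hx => h2.2.2 x hx _ rfl
      by_cases him : i = m
      · subst him
        obtain ⟨w, hl, hw, e1, e2⟩ := ih (b := j) (A := A) (B := B) hij.2.1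
          ⟨h1, h2.1, by grind, by grind, by grind⟩
        exact ⟨plain j :: w, by simp [hl], ⟨by rw [hl]; exact ⟨hij.2.1, hij.2.2.2, hij.2.2.1⟩, hw⟩,
          e1, by rw [plainPart, e2, hl]⟩
      · exact skip_case (by grind) (by grind)

theorem eq_of_parts_eq {d b : ℕ} {v w : List Step} (hv : IsNormal d b v) (hw : IsNormal d b w)
    (hl : v.length = w.length) (h1 : dotPart v = dotPart w) (h2 : plainPart v = plainPart w) :
    v = w := by
  induction v generalizing b w with
  | nil => exact (List.length_eq_zero_iff.1 hl.symm).symm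
  | cons x v ih =>
    obtain _ | ⟨y, w⟩ := w
    · simp at hl
    have hl' : v.length = w.length := by simpa using hl
    rcases x with _ | k | j <;> rcases y with _ | l | i
    · rw [ih (b := b) (w := w) hv hw hl' h1 h2]
    · have := (isPairing_of_isNormal (w := v) hv).dots_mem (w.length, l)
      simp only [dotPart] at h1
      simp [h1, hl'] at this
    · have := (isPairing_of_isNormal (w := v) hv).plain_mem (w.length, i)
      simp only [plainPart] at h2
      simp [h2, hl'] at this
    · have := (isPairing_of_isNormal (w := w) hw).dots_mem (v.length, k)
      simp only [dotPart] at h1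
      simp [← h1, hl'] at this
    · simp only [dotPart, plainPart] at h1 h2
      have := List.append_inj' h1 rfl
      simp only [List.cons.injEq, Prod.mk.injEq, and_true] at this
      rw [ih hv.2 hw.2 hl' this.1 h2, this.2.2]
    · have := (isPairing_of_isNormal hv.2).eq_nil
      simp [plainPart, this] at h2
    · have := (isPairing_of_isNormal (w := w) hw).plain_mem (v.length, j)
      simp only [plainPart] at h2
      simp [← h2, hl'] at this
    · have := (isPairing_of_isNormal hw.2).eq_nil
      simp [plainPart, this] at h2
    · simp only [dotPart, plainPart] at h1 h2
      have := List.append_inj' h2 rfl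
      simp only [List.cons.injEq, Prod.mk.injEq, and_true] at this
      obtain ⟨h3, -, rfl⟩ := this
      rw [ih hv.2 hw.2 hl' h1 h3]

theorem dotSum_eq (w : List Step) : dotSum w = ((dotPart w).map Prod.snd).sum := by
  induction w with
  | nil => rfl
  | cons a w ih => cases a <;> simp [dotSum, dotPart, ih]

theorem isPlain_iff (w : List Step) : IsPlain w ↔ dotPart w = [] := by
  induction w with
  | nil => simp [IsPlain, dotPart]
  | cons a w ih =>
    cases a with
    | skip => simp_all [IsPlain, dotPart]
    | dots k => exact iff_of_false (fun h => h k List.mem_cons_self) (by simp [dotPart])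
    | plain j => simp_all [IsPlain, dotPart]

theorem forall_eq_skip_iff (w : List Step) :
    (∀ a ∈ w, a = skip) ↔ dotPart w = [] ∧ plainPart w = [] := by
  induction w with
  | nil => simp [plainPart, dotPart]
  | cons a w ih => cases a <;> simp_all [dotPart, plainPart]

theorem mon_eq (d n : ℕ) (δ : ℂ) {b : ℕ} {w : List Step} (h : IsNormal d b w) :
    mon d n δ w =
      ((dotPart w).map fun x => Edec d n δ x.1 1 * Egen d n δ 0 ^ x.2).prod *
        ((plainPart w).map fun x => Edec d n δ x.1 x.2).prod := by
  induction w generalizing b with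
  | nil => simp [mon, dotPart, plainPart]
  | cons a w ih =>
    cases a with
    | skip => rw [mon, ih h, stepMon, mul_one]; rfl
    | dots k =>
      rw [mon, ih h.2]
      simp [dotPart, plainPart, (isPairing_of_isNormal h.2).eq_nil, stepMon]
    | plain j =>
      rw [mon, ih h.2]
      simp [dotPart, plainPart, stepMon, mul_assoc]

theorem monThree_eq (d n : ℕ) (δ : ℂ) {w : List Step} {i j : ℕ} {B : List (ℕ × ℕ)}
    (hp : dotPart w = []) (hw : plainPart w = (i, j) :: B) :
    monThree d n δ w =
      Edec d n δ i 1 * Egen d n δ 0 * Einc d n δ 1 j *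
        (B.map fun x => Edec d n δ x.1 x.2).prod := by
  induction w generalizing B with
  | nil => simp [plainPart] at hw
  | cons a w ih =>
    cases a with
    | skip => exact ih hp hw
    | dots k => simp [dotPart] at hp
    | plain l =>
      rw [monThree]
      split_ifs with h
      · simp only [plainPart, ((forall_eq_skip_iff w).1 h).2] at hw
        simp at hw
        obtain ⟨⟨rfl, rfl⟩, rfl⟩ := hw
        simp
      · rw [forall_eq_skip_iff, not_and] at h
        have h := h hp
        obtain ⟨⟨i', j'⟩, C, hC⟩ := List.exists_cons_of_ne_nil h
        simp only [plainPart, hC, List.cons_append, List.cons.injEq, Prod.mk.injEq] at hw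
        obtain ⟨⟨rfl, rfl⟩, rfl⟩ := hw
        rw [ih hp hC]
        simp [mul_assoc]

end Step

theorem List.pairwise_map_range' {α : Type*} {R : α → α → Prop} [IsTrans α R] {f : ℕ → α} {a k : ℕ}
    (h : ∀ m, a ≤ m → m + 1 < a + k → R (f m) (f (m + 1))) :
    ((List.range' a k).map f).Pairwise R := by
  have key : ∀ i j, a ≤ i → i + 1 ≤ j → j < a + k → R (f i) (f j) := by
    intro i j hi hij
    induction j, hij using Nat.le_induction with
    | base => exact fun hj => h i hi hj
    | succ j hij ih => exact fun hj => _root_.trans (ih (by omega)) (h j (by omega) hj)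
  rw [List.pairwise_map]
  refine List.Pairwise.imp_of_mem (fun {x y} hx hy hxy => ?_) List.pairwise_lt_range'
  rw [List.mem_range'_1] at hx hy
  exact key x y hx.1 hxy hy.2

theorem List.map_range'_eq_map {α β : Type*} {f : ℕ → β} {g : α → β} {a k : ℕ} {l : List α}
    (hl : l.length = k) (h : ∀ (t : ℕ) (ht : t < l.length), f (a + t) = g l[t]) :
    (List.range' a k).map f = l.map g :=
  List.ext_getElem (by simp [hl]) fun t h1 h2 => by
    simp only [List.length_map] at h2
    simp [h t h2]

theorem List.Pairwise.length_le_of_forall_lt {l : List ℕ} (h : l.Pairwise (· < ·)) {a b : ℕ}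
    (hl : ∀ x ∈ l, a ≤ x ∧ x < b) : l.length ≤ b - a := by
  rw [← List.toFinset_card_of_nodup (h.imp fun h => h.ne), ← Nat.card_Ico]
  exact Finset.card_le_card fun x hx => Finset.mem_Ico.2 (hl x (List.mem_toFinset.1 hx))

namespace Step

instance : IsTrans (ℕ × ℕ) fun x y => x.1 < y.1 := ⟨fun _ _ _ => lt_trans⟩

instance : IsTrans (ℕ × ℕ) fun x y => x.1 < y.1 ∧ x.2 < y.2 :=
  ⟨fun _ _ _ h1 h2 => ⟨h1.1.trans h2.1, h1.2.trans h2.2⟩⟩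

theorem IsPairing.length_le {d n b : ℕ} {B : List (ℕ × ℕ)} (h : IsPairing d n b [] B) :
    B.length ≤ n - 1 := by
  have h1 : (B.map Prod.fst).Pairwise (· < ·) := by
    rw [List.pairwise_map]
    exact h.pairwise_plain.imp fun h => h.1
  simpa using h1.length_le_of_forall_lt (a := 1) (b := n) fun x hx => by
    obtain ⟨y, hy, rfl⟩ := List.mem_map.1 hx
    have := h.plain_mem y hy
    omega

theorem IsPairing.length_add_length_le {d n b : ℕ} {A B : List (ℕ × ℕ)} (h : IsPairing d n b A B) :
    A.length + B.length ≤ n := by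
  have h1 : (A.map Prod.fst ++ B.map Prod.fst).Pairwise (· < ·) := by
    rw [List.pairwise_append, List.pairwise_map, List.pairwise_map]
    refine ⟨h.pairwise_dots, h.pairwise_plain.imp fun h => h.1, ?_⟩
    simpa using fun a b hab c d hcd => h.dots_lt_plain _ hab _ hcd
  simpa using h1.length_le_of_forall_lt (a := 0) (b := n) fun x hx => by
    rcases List.mem_append.1 hx with hx | hx <;> obtain ⟨y, hy, rfl⟩ := List.mem_map.1 hx
    · exact ⟨Nat.zero_le _, (h.dots_mem y hy).1⟩
    · exact ⟨Nat.zero_le _, (h.plain_mem y hy).1⟩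

theorem isPairing_nil_range' {d n a k : ℕ} {I J : ℕ → ℕ}
    (h1 : ∀ m, a ≤ m → m < a + k → I m ≤ n - 1 ∧ 1 ≤ J m ∧ J m ≤ n - 1 ∧ J m ≤ I m)
    (h2 : ∀ m, a ≤ m → m + 1 < a + k → I m < I (m + 1) ∧ J m < J (m + 1)) :
    IsPairing d n n [] ((List.range' a k).map fun m => (I m, J m)) := by
  refine ⟨List.Pairwise.nil, List.pairwise_map_range' h2, by simp, by simp, fun y hy => ?_⟩
  obtain ⟨m, hm, rfl⟩ := List.mem_map.1 hy
  rw [List.mem_range'_1] at hm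
  have := h1 m hm.1 hm.2
  dsimp only
  omega

theorem IsPairing.getD {d n : ℕ} {B : List (ℕ × ℕ)} (h : IsPairing d n n [] B) :
    (∀ m, m < B.length → 1 ≤ (B.getD m 0).1 ∧ (B.getD m 0).1 ≤ n - 1 ∧ 1 ≤ (B.getD m 0).2 ∧
        (B.getD m 0).2 ≤ n - 1 ∧ (B.getD m 0).2 ≤ (B.getD m 0).1) ∧
      ∀ m, m + 1 < B.length → (B.getD m 0).1 < (B.getD (m + 1) 0).1 ∧
        (B.getD m 0).2 < (B.getD (m + 1) 0).2 := by
  refine ⟨fun m hm => ?_, fun m hm => ?_⟩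
  · rw [List.getD_eq_getElem _ _ hm]
    have := h.plain_mem _ (List.getElem_mem hm)
    omega
  · rw [List.getD_eq_getElem _ _ hm, List.getD_eq_getElem _ _ (by omega)]
    exact List.pairwise_iff_getElem.1 h.pairwise_plain _ _ _ _ (Nat.lt_succ_self m)

theorem isStdMonI_iff {d n : ℕ} {δ : ℂ} {x : TL d n δ} :
    IsStdMonI d n δ x ↔ ∃ B : List (ℕ × ℕ), IsPairing d n n [] B ∧
      x = (B.map fun y => Edec d n δ y.1 y.2).prod := by
  constructor
  · rintro ⟨p, I, J, -, h1, h2, rfl⟩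
    refine ⟨_, isPairing_nil_range' (a := 0) (k := p) (I := I) (J := J)
      (fun m _ hm => (h1 m (by omega)).2) (fun m _ hm => h2 m (by omega)), ?_⟩
    rw [List.map_map, List.range_eq_range']
    rfl
  · rintro ⟨B, hB, rfl⟩
    obtain ⟨h1, h2⟩ := hB.getD
    refine ⟨B.length, fun m => (B.getD m 0).1, fun m => (B.getD m 0).2, hB.length_le, h1, h2, ?_⟩
    rw [List.range_eq_range', List.map_range'_eq_map (l := B)
      (g := fun y => Edec d n δ y.1 y.2) rfl]
    intro t ht
    dsimp only
    rw [zero_add, List.getD_eq_getElem _ _ ht]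

theorem isStdMonIIIOne_iff {d n : ℕ} {δ : ℂ} {x : TL d n δ} :
    IsStdMonIIIOne d n δ x ↔ ∃ (i j : ℕ) (B : List (ℕ × ℕ)), IsPairing d n n [] ((i, j) :: B) ∧
      x = Edec d n δ i 1 * Egen d n δ 0 * Einc d n δ 1 j *
        (B.map fun y => Edec d n δ y.1 y.2).prod := by
  constructor
  · rintro ⟨p, I, J, hp, -, h1, h2, rfl⟩
    have h := isPairing_nil_range' (d := d) (n := n) (a := 0) (k := p) (I := I) (J := J)
      (fun m _ hm => (h1 m (by omega)).2) (fun m _ hm => h2 m (by omega))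
    obtain ⟨p, rfl⟩ := Nat.exists_eq_add_of_le' hp
    rw [List.range'_succ, List.map_cons] at h
    refine ⟨_, _, _, h, ?_⟩
    rw [List.map_map]
    rfl
  · rintro ⟨i, j, B, hB, rfl⟩
    obtain ⟨h1, h2⟩ := hB.getD
    refine ⟨B.length + 1, fun m => (((i, j) :: B).getD m 0).1,
      fun m => (((i, j) :: B).getD m 0).2, by omega, hB.length_le, h1, h2, ?_⟩
    rw [Nat.add_sub_cancel, List.map_range'_eq_map (l := B)
      (g := fun y => Edec d n δ y.1 y.2) rfl]
    · rfl
    intro t ht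
    dsimp only
    rw [add_comm, List.getD_cons_succ, List.getD_eq_getElem _ _ ht]

theorem isStdMonIIModD_iff {d n : ℕ} (hd : 1 ≤ d) (hn : 1 ≤ n) {δ : ℂ} {x : TL d n δ} :
    IsStdMonIIModD d n δ x ↔ ∃ A B : List (ℕ × ℕ), IsPairing d n n A B ∧ A ≠ [] ∧
      (A.map Prod.snd).sum % d = 0 ∧
      x = (A.map fun x => Edec d n δ x.1 1 * Egen d n δ 0 ^ x.2).prod *
        (B.map fun x => Edec d n δ x.1 x.2).prod := by
  constructor
  · rintro ⟨p, q, I, K, J, hp, hpn, hq, hqp, h1, h2, h3, h4, h5, h6, rfl⟩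
    have hI : ∀ i j, i < j → j < p → I i < I j := by
      intro i j hij hj
      have := List.pairwise_map_range' (R := (· < ·)) (f := I) (a := 0) (k := p)
        fun m _ hm => h2 m (by omega)
      have := List.pairwise_iff_getElem.1 this i j (by simp; omega) (by simp; omega) hij
      simpa only [List.getElem_map, List.getElem_range', zero_add, one_mul] using this
    have h := isPairing_nil_range' (d := d) (n := n) (a := q) (k := p - q) (I := I) (J := J)
      (fun m hm hm' => ⟨h1 m (by omega), h5 m hm (by omega)⟩)
      (fun m hm hm' => ⟨h2 m (by omega), h6 m hm (by omega)⟩)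
    refine ⟨(List.range q).map fun m => (I m, K m), _,
      ⟨?_, h.pairwise_plain, ?_, ?_, h.plain_mem⟩, ?_, ?_, ?_⟩
    · rw [List.range_eq_range']
      exact List.pairwise_map_range' fun m _ hm => h2 m (by omega)
    · simp only [List.mem_map, List.mem_range, List.mem_range'_1]
      rintro _ ⟨i, hi, rfl⟩ _ ⟨j, hj, rfl⟩
      exact hI i j (by omega) (by omega)
    · simp only [List.mem_map, List.mem_range]
      rintro _ ⟨i, hi, rfl⟩
      have := h1 i (by omega)
      have := h3 i hi
      dsimp only
      omega
    · simpa using by omega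
    · rw [List.map_map]
      exact h4
    · rw [List.map_map, List.map_map]
      rfl
  · rintro ⟨A, B, h, hA, h4, rfl⟩
    have hA' := List.length_pos_iff.2 hA
    have hl := h.length_add_length_le
    have gA : ∀ m (hm : m < A.length), (A ++ B).getD m 0 = A[m] := fun m hm => by
      rw [List.getD_append _ _ _ _ hm, List.getD_eq_getElem _ _ hm]
    have gB : ∀ m (hm : m < B.length), (A ++ B).getD (A.length + m) 0 = B[m] := fun m hm => by
      rw [List.getD_append_right _ _ _ _ (by omega), Nat.add_sub_cancel_left,
        List.getD_eq_getElem _ _ hm]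
    have gB' : ∀ m, A.length ≤ m → m < A.length + B.length →
        ∃ (t : ℕ) (ht : t < B.length), m = A.length + t :=
      fun m h1 h2 => ⟨m - A.length, by omega, by omega⟩
    refine ⟨A.length + B.length, A.length, fun m => ((A ++ B).getD m 0).1,
      fun m => ((A ++ B).getD m 0).2, fun m => ((A ++ B).getD m 0).2, by omega, hl, by omega,
      by omega, fun m hm => ?_, fun m hm => ?_, fun m hm => ?_, ?_, fun m hm hm' => ?_,
      fun m hm hm' => ?_, ?_⟩
    · dsimp only
      rcases lt_or_ge m A.length with hm' | hm'
      · rw [gA m hm']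
        have := h.dots_mem _ (List.getElem_mem hm')
        omega
      · obtain ⟨t, ht, rfl⟩ := gB' m hm' hm
        rw [gB t ht]
        have := h.plain_mem _ (List.getElem_mem ht)
        omega
    · dsimp only
      rcases lt_or_ge m A.length with hm' | hm'
      · rw [gA m hm']
        rcases lt_or_ge (m + 1) A.length with hm1 | hm1
        · rw [gA _ hm1]
          exact List.pairwise_iff_getElem.1 h.pairwise_dots _ _ _ _ (Nat.lt_succ_self m)
        · obtain ⟨t, ht, e⟩ := gB' (m + 1) hm1 hm
          rw [e, gB t ht]
          exact h.dots_lt_plain _ (List.getElem_mem _) _ (List.getElem_mem _)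
      · obtain ⟨t, ht, rfl⟩ := gB' m hm' (by omega)
        rw [gB t ht, add_assoc, gB (t + 1) (by omega)]
        exact (List.pairwise_iff_getElem.1 h.pairwise_plain _ _ _ _ (Nat.lt_succ_self t)).1
    · dsimp only
      rw [gA m hm]
      have := h.dots_mem _ (List.getElem_mem hm)
      omega
    · rw [← h4, ← List.map_range'_eq_map (f := fun m => ((A ++ B).getD m 0).2) rfl
        (fun t ht => by rw [zero_add, gA t ht]), ← List.range_eq_range']
      rfl
    · dsimp only
      obtain ⟨t, ht, rfl⟩ := gB' m hm hm'
      rw [gB t ht]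
      have := h.plain_mem _ (List.getElem_mem ht)
      omega
    · dsimp only
      obtain ⟨t, ht, rfl⟩ := gB' m hm (by omega)
      rw [gB t ht, add_assoc, gB (t + 1) (by omega)]
      exact (List.pairwise_iff_getElem.1 h.pairwise_plain _ _ _ _ (Nat.lt_succ_self t)).2
    · rw [List.range_eq_range', Nat.add_sub_cancel_left,
        List.map_range'_eq_map (l := A) (g := fun x => Edec d n δ x.1 1 * Egen d n δ 0 ^ x.2) rfl
          (fun t ht => by dsimp only; rw [zero_add, gA t ht]),
        List.map_range'_eq_map (l := B) (g := fun x => Edec d n δ x.1 x.2) rfl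
          (fun t ht => by dsimp only; rw [gB t ht])]

end Step

namespace Step

theorem spanSetTddn_eq_range {d n : ℕ} (hd : 1 ≤ d) (hn : 1 ≤ n) (δ : ℂ) :
    spanSetTddn d n δ = Set.range (Sum.elim (fun w : wordsTwo d n => mon d n δ w)
      (fun w : wordsThree d n => monThree d n δ w)) := by
  ext x
  simp only [spanSetTddn, Set.mem_ofPred_eq, isStdMonI_iff, isStdMonIIModD_iff hd hn,
    isStdMonIIIOne_iff, Set.Sum.elim_range, Set.mem_union, Set.mem_range, Subtype.exists]
  constructor
  · rintro (⟨B, h, rfl⟩ | ⟨A, B, h, -, hs, rfl⟩ | ⟨i, j, B, h, rfl⟩)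
    · obtain ⟨w, hl, hw, hA, hB⟩ := exists_isNormal hn n h
      refine Or.inl ⟨w, ⟨hl, hw, ?_⟩, ?_⟩
      · simp [dotSum_eq, hA]
      · simp [mon_eq d n δ hw, hA, hB]
    · obtain ⟨w, hl, hw, rfl, rfl⟩ := exists_isNormal hn n h
      exact Or.inl ⟨w, ⟨hl, hw, by rwa [dotSum_eq]⟩, mon_eq d n δ hw⟩
    · obtain ⟨w, hl, hw, hA, hB⟩ := exists_isNormal hn n h
      refine Or.inr ⟨w, ⟨hl, hw, (isPlain_iff w).2 hA, ?_⟩, monThree_eq d n δ hA hB⟩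
      rw [forall_eq_skip_iff, hB]
      simp
  · rintro (⟨w, ⟨hl, hw, hs⟩, rfl⟩ | ⟨w, ⟨hl, hw, hp, hne⟩, rfl⟩)
    · have h := isPairing_of_isNormal hw
      rw [hl] at h
      by_cases hA : dotPart w = []
      · rw [hA] at h
        exact Or.inl ⟨_, h, by simp [mon_eq d n δ hw, hA]⟩
      · exact Or.inr (Or.inl ⟨_, _, h, hA, by rwa [← dotSum_eq], mon_eq d n δ hw⟩)
    · have h := isPairing_of_isNormal hw
      rw [isPlain_iff] at hp
      rw [hl, hp] at h
      obtain ⟨⟨i, j⟩, B, hB⟩ := List.exists_cons_of_ne_nil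
        fun h => hne ((forall_eq_skip_iff w).2 ⟨hp, h⟩)
      rw [hB] at h
      exact Or.inr (Or.inr ⟨i, j, B, h, monThree_eq d n δ hp hB⟩)

end Step

section CatalanTriangle

open Nat

theorem catalanTri_mul {n k : ℕ} (h : k ≤ n) :
    catalanTri n k * (k ! * (n + 1)!) = (n + k)! * (n - k + 1) := by
  refine Nat.div_mul_cancel ?_
  rcases k with _ | k
  · simp [Nat.factorial_succ, mul_comm]
  obtain ⟨c, rfl⟩ := Nat.exists_eq_add_of_le h
  have h1 := Nat.choose_mul_factorial_mul_factorial (n := k + 1 + c + (k + 1)) (k := k + 1)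
    (by omega)
  have h2 := Nat.choose_mul_factorial_mul_factorial (n := k + 1 + c + (k + 1)) (k := k) (by omega)
  rw [Nat.add_sub_cancel] at h1
  rw [show k + 1 + c + (k + 1) - k = k + 1 + c + 1 by omega] at h2
  rw [Nat.add_sub_cancel_left]
  generalize k + 1 + c + (k + 1) = N at *
  rw [← Int.natCast_dvd_natCast]
  refine ⟨N.choose (k + 1) - N.choose k, ?_⟩
  rw [Nat.factorial_succ k] at h1 ⊢
  rw [Nat.factorial_succ (k + 1 + c)] at h2 ⊢
  zify at h1 h2
  push_cast
  linear_combination -(k + 2 + c : ℤ) * h1 + (k + 1 : ℤ) * h2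

theorem catalanTri_zero_right (n : ℕ) : catalanTri n 0 = 1 := by
  have := catalanTri_mul (Nat.zero_le n)
  rw [Nat.factorial_zero, one_mul, add_zero, Nat.sub_zero, mul_comm n !,
    ← Nat.factorial_succ] at this
  exact Nat.eq_of_mul_eq_mul_right (n + 1).factorial_pos (by rw [this, one_mul])

theorem catalanTri_succ_succ {n k : ℕ} (h : k + 1 ≤ n) :
    catalanTri (n + 1) (k + 1) = catalanTri (n + 1) k + catalanTri n (k + 1) := by
  obtain ⟨c, rfl⟩ := Nat.exists_eq_add_of_le h
  have h1 := catalanTri_mul (n := k + 1 + c + 1) (k := k + 1) (by omega)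
  have h2 := catalanTri_mul (n := k + 1 + c + 1) (k := k) (by omega)
  have h3 := catalanTri_mul (n := k + 1 + c) (k := k + 1) (by omega)
  rw [show k + 1 + c + 1 - (k + 1) = c + 1 by omega,
    show k + 1 + c + 1 + (k + 1) = k + 1 + c + (k + 1) + 1 by omega,
    Nat.factorial_succ (k + 1 + c + (k + 1))] at h1
  rw [show k + 1 + c + 1 - k = c + 2 by omega,
    show k + 1 + c + 1 + k = k + 1 + c + (k + 1) by omega] at h2
  rw [Nat.add_sub_cancel_left] at h3
  refine Nat.eq_of_mul_eq_mul_right (Nat.mul_pos (k + 1).factorial_pos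
    (k + 1 + c + 1 + 1).factorial_pos) ?_
  rw [h1, add_mul, Nat.factorial_succ (k + 1 + c + 1)]
  rw [Nat.factorial_succ k] at *
  rw [Nat.factorial_succ (k + 1 + c + 1)] at h2
  zify at *
  linear_combination (-(k : ℤ) - 1) * h2 - (k + 1 + c + 2 : ℤ) * h3

theorem catalanTri_self (n : ℕ) : catalanTri n n = catalanNum n := by
  rw [catalanTri, catalanNum, Nat.sub_self, zero_add, mul_one,
    Nat.choose_eq_factorial_div_factorial (by omega), Nat.div_div_eq_div_mul, Nat.factorial_succ, ← two_mul]
  congr 1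
  rw [two_mul, Nat.add_sub_cancel]
  ring

theorem catalanTri_succ_self (n : ℕ) : catalanTri (n + 1) n = catalanNum (n + 1) := by
  have h1 := catalanTri_mul (n := n + 1) (k := n + 1) le_rfl
  have h2 := catalanTri_mul (n := n + 1) (k := n) (by omega)
  rw [← catalanTri_self]
  refine Nat.eq_of_mul_eq_mul_right (Nat.mul_pos (n + 1).factorial_pos (n + 2).factorial_pos) ?_
  rw [h1, Nat.factorial_succ n, ← add_assoc, Nat.factorial_succ (n + 1 + n)]
  rw [show n + 1 - n = 1 by omega] at h2
  rw [Nat.sub_self]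
  zify at *
  linear_combination (n + 1 : ℤ) * h2

theorem sum_catalanTri {k t : ℕ} (h : t ≤ k) :
    ∑ s ∈ Finset.range (t + 1), catalanTri k s = catalanTri (k + 1) t := by
  induction t with
  | zero => simp [catalanTri_zero_right]
  | succ t ih => rw [Finset.sum_range_succ, ih (by omega), catalanTri_succ_succ h]

theorem catalanTriPoly_add (n x : ℕ) :
    catalanTriPoly (n + 1) (n + 1) x + catalanTriPoly (n + 2) n x =
      x * catalanTriPoly (n + 2) n x + catalanNum (n + 2) := by
  have h1 : catalanTriPoly (n + 2) (n + 1) x =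
      x * catalanTriPoly (n + 2) n x + catalanNum (n + 2) := by
    rw [catalanTriPoly, Finset.sum_range_succ, Nat.sub_self, pow_zero, mul_one,
      catalanTri_succ_self, catalanTriPoly, Finset.mul_sum]
    congr 1
    refine Finset.sum_congr rfl fun s hs => ?_
    rw [Nat.succ_sub (Finset.mem_range_succ_iff.1 hs), pow_succ]
    ring
  rw [← h1]
  simp only [catalanTriPoly]
  rw [Finset.sum_range_succ' _ (n + 1), Finset.sum_range_succ' _ (n + 1), catalanTri_zero_right,
    catalanTri_zero_right, add_right_comm, ← Finset.sum_add_distrib]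
  congr 1
  refine Finset.sum_congr rfl fun s hs => ?_
  rw [Nat.add_sub_add_right, catalanTri_succ_succ (n := n + 1) (by simpa using hs)]
  ring

/-- Summation by parts: `catalanTri k (k - j)` are the numbers of iterated partial sums. -/
theorem sum_catalanTri_mul_sum (k : ℕ) (f : ℕ → ℕ) :
    ∑ j ∈ Finset.range (k + 1), catalanTri k (k - j) * ∑ i ∈ Finset.range (j + 2), f i =
      ∑ i ∈ Finset.range (k + 2), catalanTri (k + 1) (k + 1 - i) * f i := by
  simp only [Finset.mul_sum]
  rw [Finset.sum_comm' (t' := Finset.range (k + 2)) (s' := fun i => Finset.Ico (i - 1) (k + 1))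
    fun j i => by simp only [Finset.mem_range, Finset.mem_Ico]; omega]
  refine Finset.sum_congr rfl fun i hi => ?_
  rw [← Finset.sum_mul, Finset.sum_Ico_reflect (catalanTri k) (i - 1) le_rfl, Nat.sub_self,
    ← Finset.range_eq_Ico]
  congr 1
  rcases i with _ | i
  · rw [Nat.zero_sub, Nat.sub_zero, sum_catalanTri le_rfl, catalanTri_succ_self,
      catalanTri_self]
  · rw [Finset.mem_range] at hi
    rw [← sum_catalanTri (by omega)]
    congr 2
    omega

theorem eq_catalanTriPoly_of_rec {T : ℕ → ℕ → ℕ} {d : ℕ} (h1 : ∀ m, T (m + 1) 1 = d ^ m)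
    (h2 : ∀ m b, 1 ≤ b → b ≤ m → T (m + 1) (b + 1) = T (m + 1) b + T m (b + 1))
    (h3 : ∀ m, T (m + 1) (m + 2) = T (m + 1) (m + 1)) (n : ℕ) :
    T (n + 1) (n + 1) = catalanTriPoly n n d := by
  have h4 : ∀ b r, T (r + b + 2) (b + 2) = ∑ i ∈ Finset.range (r + 2), T (i + b + 1) (b + 1) := by
    intro b r
    induction r with
    | zero =>
      rw [zero_add, h2 (b + 1) (b + 1) (by omega) le_rfl, h3, Finset.sum_range_succ,
        Finset.sum_range_one, add_comm, zero_add, Nat.add_comm 1 b]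
    | succ r ih =>
      rw [Finset.sum_range_succ, ← ih, show r + 1 + b + 2 = r + b + 2 + 1 by ring,
        h2 (r + b + 2) (b + 1) (by omega) (by omega), add_comm,
        show r + 2 + b + 1 = r + b + 2 + 1 by ring]
  have h5 : ∀ k b, T (k + b + 1) (k + b + 1) =
      ∑ j ∈ Finset.range (k + 1), catalanTri k (k - j) * T (j + b + 1) (b + 1) := by
    intro k
    induction k with
    | zero => simp [catalanTri_zero_right]
    | succ k ih =>
      intro b
      rw [show k + 1 + b + 1 = k + (b + 1) + 1 by ring, ih, ← sum_catalanTri_mul_sum]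
      simp only [← add_assoc, ← h4]
  have := h5 n 0
  simp only [add_zero, zero_add, h1] at this
  rw [this, catalanTriPoly, ← Finset.sum_range_reflect]
  refine Finset.sum_congr rfl fun s hs => ?_
  rw [Finset.mem_range_succ_iff] at hs
  rw [Nat.add_sub_cancel, Nat.sub_sub_self hs]

end CatalanTriangle

namespace Step

open Classical in
/-- The normal words of length `m` whose exponents sum to `r` modulo `d`. -/
noncomputable def words (d : ℕ) : ℕ → ℕ → ZMod d → Finset (List Step)
  | 0, _, r => if r = 0 then {[]} else ∅
  | m + 1, b, r => (words d m b r).image (List.cons skip) ∪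
      ((Finset.Ico 1 d).biUnion fun k => (words d m 1 (r - k)).image (List.cons (dots k))) ∪
      (Finset.Ico 1 (min b (m + 1))).biUnion fun j => (words d m j r).image (List.cons (plain j))

theorem mem_words {d m b : ℕ} {r : ZMod d} {w : List Step} :
    w ∈ words d m b r ↔ w.length = m ∧ IsNormal d b w ∧ (dotSum w : ZMod d) = r := by
  induction m generalizing b r w with
  | zero =>
    rw [List.length_eq_zero_iff, words]
    split_ifs with h
    · subst h
      simp only [Finset.mem_singleton]
      exact ⟨fun h => by subst h; simp [IsNormal, dotSum], fun h => h.1⟩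
    · simp only [Finset.notMem_empty, false_iff]
      rintro ⟨rfl, -, h1⟩
      exact h (by simpa [dotSum] using h1.symm)
  | succ m ih =>
    simp only [words, Finset.mem_union, Finset.mem_image, Finset.mem_biUnion, Finset.mem_Ico, ih]
    rcases w with _ | ⟨_ | k | j, w⟩
    · simp
    · simp [IsNormal, dotSum]
    · simp only [IsNormal, dotSum, Nat.cast_add]
      grind
    · simp only [IsNormal, dotSum]
      grind

theorem card_words_succ (d m b : ℕ) (r : ZMod d) : (words d (m + 1) b r).card =
    (words d m b r).card + ∑ k ∈ Finset.Ico 1 d, (words d m 1 (r - k)).card +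
      ∑ j ∈ Finset.Ico 1 (min b (m + 1)), (words d m j r).card := by
  classical
  have h1 : ∀ (a : Step) (s : Finset (List Step)), (s.image (List.cons a)).card = s.card :=
    fun a s => Finset.card_image_of_injective _ List.cons_injective
  rw [words, Finset.card_union_of_disjoint, Finset.card_union_of_disjoint, Finset.card_biUnion,
    Finset.card_biUnion]
  · simp only [h1]
  all_goals
    simp only [Set.PairwiseDisjoint, Set.Pairwise, Function.onFun, Finset.disjoint_left,
      Finset.mem_union, Finset.mem_image, Finset.mem_biUnion]
    grind

theorem _root_.ZMod.sum_range_sub {d : ℕ} [NeZero d] (f : ZMod d → ℕ) (r : ZMod d) :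
    ∑ k ∈ Finset.range d, f (r - k) = ∑ x, f x := by
  rw [← Fintype.sum_equiv (Equiv.subLeft r) (fun x => f (r - x)) f fun _ => rfl]
  exact Finset.sum_nbij' (fun k => (k : ZMod d)) ZMod.val (by simp) (by simp [ZMod.val_lt])
    (fun k hk => ZMod.val_cast_of_lt (Finset.mem_range.1 hk)) (by simp) (by simp)

theorem card_words_one {d : ℕ} [NeZero d] (m : ℕ) (r : ZMod d) :
    (words d (m + 1) 1 r).card = d ^ m := by
  have h : ∀ m r, (words d (m + 1) 1 r).card = ∑ x, (words d m 1 x).card := by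
    intro m r
    rw [card_words_succ, ← ZMod.sum_range_sub _ r, Finset.sum_range_eq_add_Ico _ (NeZero.pos d)]
    simp
  induction m generalizing r with
  | zero =>
    rw [h]
    simp only [words]
    simp [apply_ite]
  | succ m ih =>
    rw [h]
    simp [ih, ZMod.card, pow_succ']

theorem isNormal_succ {d b : ℕ} {w : List Step} (h : w.length ≤ b) :
    IsNormal d (b + 1) w ↔ IsNormal d b w := by
  induction w with
  | nil => rfl
  | cons a w ih =>
    rw [List.length_cons] at h
    rcases a with _ | k | j
    · exact ih (by omega)
    · rfl
    · simp only [IsNormal]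
      grind

theorem card_words_self {d : ℕ} (hd : 1 ≤ d) (n : ℕ) :
    (words d (n + 1) (n + 1) 0).card = catalanTriPoly n n d := by
  have : NeZero d := ⟨by omega⟩
  refine eq_catalanTriPoly_of_rec (T := fun m b => (words d m b 0).card)
    (fun m => card_words_one m 0) (fun m b hb hm => ?_) (fun m => ?_) n
  · rw [card_words_succ, card_words_succ, min_eq_left (by omega), min_eq_left (by omega),
      Finset.sum_Ico_succ_top hb]
    ring
  · congr 1
    ext w
    simp only [mem_words]
    exact and_congr_right fun h => and_congr_left' (isNormal_succ h.le)

end Step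

/-- The tuples that index the standard monomials of type (ii). -/
def IsTuple (d n : ℕ) (x : List ℕ × List ℕ × List ℕ) : Prop :=
  1 ≤ x.1.length ∧ x.1.length ≤ n ∧
  1 ≤ x.2.1.length ∧ x.2.1.length ≤ x.1.length ∧
  x.2.2.length = x.1.length - x.2.1.length ∧
  x.1.IsChain (· < ·) ∧ (∀ i ∈ x.1, i ≤ n - 1) ∧
  (∀ k ∈ x.2.1, 1 ≤ k ∧ k ≤ d - 1) ∧
  x.2.1.sum % d = 0 ∧
  x.2.2.IsChain (· < ·) ∧ (∀ j ∈ x.2.2, 1 ≤ j ∧ j ≤ n - 1) ∧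
  (∀ (t : ℕ) (h1 : t < x.2.2.length) (h2 : x.2.1.length + t < x.1.length),
    x.2.2.get ⟨t, h1⟩ ≤ x.1.get ⟨x.2.1.length + t, h2⟩)

namespace Step

/-- The tuple of indices of a pair of lists of pairs of indices. -/
def toTuple (x : List (ℕ × ℕ) × List (ℕ × ℕ)) : List ℕ × List ℕ × List ℕ :=
  (x.1.map Prod.fst ++ x.2.map Prod.fst, x.1.map Prod.snd, x.2.map Prod.snd)

theorem toTuple_injective : Function.Injective toTuple := by
  rintro ⟨A, B⟩ ⟨A', B'⟩ h
  simp only [toTuple, Prod.mk.injEq] at h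
  obtain ⟨h1, h2, h3⟩ := h
  have hl : A.length = A'.length := by simpa using congrArg List.length h2
  obtain ⟨h4, h5⟩ := List.append_inj h1 (by simpa using hl)
  rw [← List.zip_unzip A, ← List.zip_unzip A', ← List.zip_unzip B, ← List.zip_unzip B']
  simp only [List.unzip_eq_map, h2, h3, h4, h5]

theorem exists_toTuple_eq {I K J : List ℕ} (h1 : K.length ≤ I.length)
    (h2 : J.length = I.length - K.length) : ∃ x, toTuple x = (I, K, J) := by
  refine ⟨((I.take K.length).zip K, (I.drop K.length).zip J), ?_⟩
  simp only [toTuple]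
  rw [List.map_fst_zip, List.map_fst_zip, List.map_snd_zip, List.map_snd_zip, List.take_append_drop]
    <;> simp <;> omega

theorem isPairing_iff {d m b : ℕ} {A B : List (ℕ × ℕ)} : IsPairing d m b A B ↔
    (A.map Prod.fst ++ B.map Prod.fst).Pairwise (· < ·) ∧ (B.map Prod.snd).Pairwise (· < ·) ∧
      (∀ x ∈ A, x.1 < m ∧ 1 ≤ x.2 ∧ x.2 < d) ∧
        ∀ y ∈ B, y.1 < m ∧ 1 ≤ y.2 ∧ y.2 ≤ y.1 ∧ y.2 < b := by
  have h : (∀ x ∈ A.map Prod.fst, ∀ y ∈ B.map Prod.fst, x < y) ↔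
      ∀ x ∈ A, ∀ y ∈ B, x.1 < y.1 := by simp
  rw [List.pairwise_append, List.pairwise_map, List.pairwise_map, List.pairwise_map, h]
  exact ⟨fun h => ⟨⟨h.1, h.2.imp fun h => h.1, h.3⟩, h.2.imp fun h => h.2, h.4, h.5⟩,
    fun h => ⟨h.1.1, h.1.2.1.and h.2.1, h.1.2.2, h.2.2.1, h.2.2.2⟩⟩

theorem isTuple_toTuple_iff {d n : ℕ} (hd : 1 ≤ d) (hn : 1 ≤ n) {x : List (ℕ × ℕ) × List (ℕ × ℕ)} :
    IsTuple d n (toTuple x) ↔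
      IsPairing d n n x.1 x.2 ∧ x.1 ≠ [] ∧ (x.1.map Prod.snd).sum % d = 0 := by
  obtain ⟨A, B⟩ := x
  have h : (∀ (t : ℕ) (h1 : t < (B.map Prod.snd).length)
      (h2 : (A.map Prod.snd).length + t < (A.map Prod.fst ++ B.map Prod.fst).length),
      (B.map Prod.snd).get ⟨t, h1⟩ ≤
        (A.map Prod.fst ++ B.map Prod.fst).get ⟨(A.map Prod.snd).length + t, h2⟩) ↔
      ∀ y ∈ B, y.2 ≤ y.1 := by
    simp [List.forall_mem_iff_forall_getElem, List.getElem_append_right]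
  simp only [IsTuple, toTuple, h]
  constructor
  · rintro ⟨-, -, h3, -, -, h4, h5, h6, h7, h8, h9, h10⟩
    rw [List.length_map] at h3
    simp only [List.mem_append, List.mem_map] at h5 h6 h9
    refine ⟨isPairing_iff.2 ⟨List.isChain_iff_pairwise.1 h4, List.isChain_iff_pairwise.1 h8,
      ?_, ?_⟩, List.length_pos_iff.1 h3, h7⟩
    · intro x hx
      have := h5 _ (Or.inl ⟨x, hx, rfl⟩)
      have := h6 _ ⟨x, hx, rfl⟩
      omega
    · intro x hx
      have := h5 _ (Or.inr ⟨x, hx, rfl⟩)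
      have := h9 _ ⟨x, hx, rfl⟩
      have := h10 x hx
      omega
  · rintro ⟨h1, h2, h3⟩
    have hl := h1.length_add_length_le
    have h2 := List.length_pos_iff.2 h2
    obtain ⟨h4, h5, h6, h7⟩ := isPairing_iff.1 h1
    refine ⟨?_, ?_, ?_, ?_, ?_, List.isChain_iff_pairwise.2 h4, ?_, ?_, h3,
      List.isChain_iff_pairwise.2 h5, ?_, fun y hy => (h7 y hy).2.2.1⟩
    any_goals simp only [List.length_append, List.length_map]; omega
    all_goals simp only [List.mem_append, List.mem_map]
    · rintro _ (⟨x, hx, rfl⟩ | ⟨x, hx, rfl⟩)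
      · have := h6 x hx
        omega
      · have := h7 x hx
        omega
    · rintro _ ⟨x, hx, rfl⟩
      have := h6 x hx
      omega
    · rintro _ ⟨x, hx, rfl⟩
      have := h7 x hx
      omega

theorem isNormal_one_iff {d b : ℕ} {w : List Step} :
    IsNormal 1 b w ↔ IsNormal d b w ∧ IsPlain w := by
  induction w generalizing b with
  | nil => simp [IsNormal, IsPlain]
  | cons a w ih =>
    simp only [IsPlain] at ih ⊢
    rcases a with _ | k | j
    · simp [IsNormal, ih]
    · simp only [IsNormal]
      refine ⟨fun h => by omega, fun h => absurd (List.mem_cons_self) (h.2 k)⟩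
    · simp [IsNormal, ih, and_assoc]

theorem dotSum_eq_zero {w : List Step} (h : IsPlain w) : dotSum w = 0 := by
  rw [dotSum_eq, (isPlain_iff w).1 h]
  rfl

theorem wordsTwo_eq (d n : ℕ) : wordsTwo d n = words d n n 0 := by
  ext w
  rw [Finset.mem_coe, mem_words, ZMod.natCast_eq_zero_iff, Nat.dvd_iff_mod_eq_zero]
  rfl

theorem mem_words_one {d n : ℕ} {w : List Step} :
    w ∈ words 1 n n 0 ↔ w ∈ words d n n 0 ∧ IsPlain w := by
  rw [mem_words, mem_words, isNormal_one_iff (d := d)]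
  constructor
  · rintro ⟨h1, ⟨h2, h3⟩, -⟩
    exact ⟨⟨h1, h2, by rw [dotSum_eq_zero h3, Nat.cast_zero]⟩, h3⟩
  · rintro ⟨⟨h1, h2, -⟩, h3⟩
    exact ⟨h1, ⟨h2, h3⟩, Subsingleton.elim _ _⟩

theorem isNormal_replicate_skip (d b m : ℕ) : IsNormal d b (List.replicate m skip) := by
  induction m with
  | zero => trivial
  | succ m ih => exact ih

theorem wordsThree_eq (d n : ℕ) :
    wordsThree d n = (words 1 n n 0 : Set (List Step)) \ {List.replicate n skip} := by
  ext w
  rw [Set.mem_sdiff, Finset.mem_coe, mem_words_one (d := d), mem_words, Set.mem_singleton_iff,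
    List.eq_replicate_iff]
  constructor
  · rintro ⟨h1, h2, h3, h4⟩
    exact ⟨⟨⟨h1, h2, by rw [dotSum_eq_zero h3, Nat.cast_zero]⟩, h3⟩, fun h => h4 h.2⟩
  · rintro ⟨⟨⟨h1, h2, -⟩, h3⟩, h4⟩
    exact ⟨h1, h2, h3, fun h => h4 ⟨h1, h⟩⟩

theorem card_words_one_self (n : ℕ) : (words 1 (n + 2) (n + 2) 0).card = catalanNum (n + 2) := by
  rw [card_words_self le_rfl]
  have := catalanTriPoly_add n 1
  omega

theorem card_words_eq {d : ℕ} (hd : 1 ≤ d) (n : ℕ) : (words d (n + 2) (n + 2) 0).card =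
    (d - 1) * catalanTriPoly (n + 2) n d + catalanNum (n + 2) := by
  rw [card_words_self hd]
  have := catalanTriPoly_add n d
  obtain ⟨d, rfl⟩ := Nat.exists_eq_add_of_le' hd
  rw [Nat.add_sub_cancel]
  linarith

theorem setOf_isTuple_eq {d n : ℕ} (hd : 1 ≤ d) (hn : 1 ≤ n) :
    {x | IsTuple d n x} = (fun w => toTuple (dotPart w, plainPart w)) ''
      (words d n n 0 \ words 1 n n 0 : Set (List Step)) := by
  ext x
  simp only [Set.mem_ofPred_eq, Set.mem_image, Set.mem_sdiff, ← wordsTwo_eq d, Finset.mem_coe,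
    mem_words_one (d := d), isPlain_iff]
  simp only [← Finset.mem_coe, ← wordsTwo_eq]
  constructor
  · intro hx
    obtain ⟨I, K, J⟩ := x
    obtain ⟨⟨A, B⟩, h⟩ := exists_toTuple_eq hx.2.2.2.1 hx.2.2.2.2.1
    rw [← h] at hx ⊢
    obtain ⟨h1, h2, h3⟩ := (isTuple_toTuple_iff hd hn).1 hx
    obtain ⟨w, hl, hw, rfl, rfl⟩ := exists_isNormal hn n h1
    exact ⟨w, ⟨⟨hl, hw, by rwa [dotSum_eq]⟩, fun h => h2 h.2⟩, rfl⟩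
  · rintro ⟨w, ⟨⟨hl, hw, hs⟩, h⟩, rfl⟩
    refine (isTuple_toTuple_iff hd hn).2 ⟨?_, fun h' => h ⟨⟨hl, hw, hs⟩, h'⟩, by rwa [← dotSum_eq]⟩
    have := isPairing_of_isNormal hw
    rwa [hl] at this

theorem card_isTuple {d : ℕ} (hd : 1 ≤ d) (n : ℕ) :
    Nat.card {x // IsTuple d (n + 2) x} = (d - 1) * catalanTriPoly (n + 2) n d := by
  have h := setOf_isTuple_eq hd (n := n + 2) (by omega)
  change Nat.card {x | IsTuple d (n + 2) x} = _
  rw [Nat.card_coe_set_eq, h, Set.InjOn.ncard_image, Set.ncard_sdiff, Set.ncard_coe_finset,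
    Set.ncard_coe_finset, card_words_one_self, card_words_eq hd, Nat.add_sub_cancel]
  · exact fun w hw => (mem_words_one.1 hw).1
  · rintro v ⟨hv, -⟩ w ⟨hw, -⟩ h
    rw [Finset.mem_coe, mem_words] at hv hw
    have := Prod.mk.inj (toTuple_injective h)
    exact eq_of_parts_eq hv.2.1 hw.2.1 (hv.1.trans hw.1.symm) this.1 this.2

theorem finrank_span_spanSetTddn {d : ℕ} (hd : 2 ≤ d) (n : ℕ) (δ : ℂ) :
    Module.finrank ℂ (Submodule.span ℂ (spanSetTddn d (n + 2) δ)) =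
      (d - 1) * catalanTriPoly (n + 2) n d + 2 * catalanNum (n + 2) - 1 := by
  have hn : 1 ≤ n + 2 := by omega
  have h2 : (wordsTwo d (n + 2)).Finite := by
    rw [wordsTwo_eq]
    exact Finset.finite_toSet _
  have h3 : (wordsThree d (n + 2)).Finite := by
    rw [wordsThree_eq]
    exact (Finset.finite_toSet _).sdiff
  have := h2.fintype
  have := h3.fintype
  have hmem : List.replicate (n + 2) skip ∈ words 1 (n + 2) (n + 2) 0 := by
    refine mem_words.2 ⟨List.length_replicate, isNormal_replicate_skip _ _ _, Subsingleton.elim _ _⟩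
  rw [spanSetTddn_eq_range (by omega) hn, finrank_span_eq_card (linearIndependent_mon hd hn δ),
    Fintype.card_sum, ← Nat.card_eq_fintype_card, ← Nat.card_eq_fintype_card, Nat.card_coe_set_eq,
    Nat.card_coe_set_eq, wordsTwo_eq, wordsThree_eq, Set.ncard_sdiff_singleton_of_mem hmem,
    Set.ncard_coe_finset, Set.ncard_coe_finset, card_words_one_self, card_words_eq (by omega)]
  have : 0 < catalanNum (n + 2) := by
    rw [← card_words_one_self]
    exact Finset.card_pos.2 ⟨_, hmem⟩
  omega

end Step

/-- The number of type (ii) tuples with `k_1 + ⋯ + k_q ≡ 0 (mod d)` equals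
`(d−1)·𝔉_{n,n−2}(d)`, and the dimension of the subalgebra `𝒯(d,d,n)` of `𝒯(d,n)`
equals `(d−1)·𝔉_{n,n−2}(d) + 2·C_n − 1`. -/
theorem dim_Tddn (d n : ℕ) (hd : 2 ≤ d) (hn : 2 ≤ n) (δ : ℂ) :
    (Nat.card {x : List ℕ × List ℕ × List ℕ //
        1 ≤ x.1.length ∧ x.1.length ≤ n ∧
        1 ≤ x.2.1.length ∧ x.2.1.length ≤ x.1.length ∧
        x.2.2.length = x.1.length - x.2.1.length ∧
        x.1.Chain' (· < ·) ∧ (∀ i ∈ x.1, i ≤ n - 1) ∧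
        (∀ k ∈ x.2.1, 1 ≤ k ∧ k ≤ d - 1) ∧
        x.2.1.sum % d = 0 ∧
        x.2.2.Chain' (· < ·) ∧ (∀ j ∈ x.2.2, 1 ≤ j ∧ j ≤ n - 1) ∧
        (∀ (t : ℕ) (h1 : t < x.2.2.length) (h2 : x.2.1.length + t < x.1.length),
          x.2.2.get ⟨t, h1⟩ ≤ x.1.get ⟨x.2.1.length + t, h2⟩)} =
      (d - 1) * catalanTriPoly n (n - 2) d) ∧
    Module.finrank ℂ (Submodule.span ℂ (spanSetTddn d n δ)) =
      (d - 1) * catalanTriPoly n (n - 2) d + 2 * catalanNum n - 1 := by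
  obtain ⟨n, rfl⟩ := Nat.exists_eq_add_of_le' hn
  exact ⟨Step.card_isTuple (by omega) n, Step.finrank_span_spanSetTddn hd n δ⟩
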